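/- Let n ≥ 2 and 0 < μ < n. Suppose u ∈ Cⁿ(ℝⁿ) satisfies condition (B) and the integral equation (IE). If b ∈ ℝⁿ is such that λ_b > 0, then w_{λ_b,b}(x) = 0 and z_{λ_b,b}(x) = 0 for every x ∈ ℝⁿ with 0 < |x| < λ_b. -/

import Mathlib

open MeasureTheory Real Filter Metric

noncomputable section

/-- The nonlocal term `v(x) = ∫ e^{((2n-μ)/2) u(y)} / |x-y|^μ dy`. -/
noncomputable def V (n : ℕ) (μ : ℝ) (u : EuclideanSpace ℝ (Fin n) → ℝ)
    (x : EuclideanSpace ℝ (Fin n)) : ℝ :=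
  ∫ y : EuclideanSpace ℝ (Fin n),
    Real.exp ((2 * n - μ) / 2 * u y) / ‖x - y‖ ^ μ

/-- `βₙ = 2^{n-1} Γ(n/2+1) Γ(n/2) ωₙ` with `ωₙ` the volume of the unit ball in `ℝⁿ`. -/
noncomputable def betaN (n : ℕ) : ℝ :=
  2 ^ (n - 1) * Real.Gamma ((n : ℝ) / 2 + 1) * Real.Gamma ((n : ℝ) / 2) *
    (volume (Metric.ball (0 : EuclideanSpace ℝ (Fin n)) 1)).toReal

/-- Condition (B): finite weighted volume and finite total curvature. -/
def CondB (n : ℕ) (μ : ℝ) (u : EuclideanSpace ℝ (Fin n) → ℝ) : Prop :=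
  Integrable (fun y : EuclideanSpace ℝ (Fin n) => Real.exp ((2 * n - μ) / 2 * u y)) ∧
  Integrable (fun p : EuclideanSpace ℝ (Fin n) × EuclideanSpace ℝ (Fin n) =>
    Real.exp ((2 * n - μ) / 2 * u p.1) * Real.exp ((2 * n - μ) / 2 * u p.2) / ‖p.1 - p.2‖ ^ μ)

/-- The integral equation (IE). -/
def IE (n : ℕ) (μ : ℝ) (u : EuclideanSpace ℝ (Fin n) → ℝ) : Prop :=
  ∃ C : ℝ, ∀ x : EuclideanSpace ℝ (Fin n), u x = (1 / betaN n) *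
    (∫ y, Real.log ((‖y‖ + 1) / ‖x - y‖) * (V n μ u y * Real.exp ((2 * n - μ) / 2 * u y))) + C

/-- `α = (1/βₙ) ∫ v(y) e^{((2n-μ)/2) u(y)} dy`. -/
noncomputable def alphaC (n : ℕ) (μ : ℝ) (u : EuclideanSpace ℝ (Fin n) → ℝ) : ℝ :=
  (1 / betaN n) * ∫ y, V n μ u y * Real.exp ((2 * n - μ) / 2 * u y)

/-- `w_{λ,b}(x) = u(b + x/|x|²) − 2 ln|x| − u(b + x/λ²) + 2 ln λ`. -/
noncomputable def wMS (n : ℕ) (u : EuclideanSpace ℝ (Fin n) → ℝ)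
    (b : EuclideanSpace ℝ (Fin n)) (l : ℝ) (x : EuclideanSpace ℝ (Fin n)) : ℝ :=
  u (b + (‖x‖ ^ 2)⁻¹ • x) - 2 * Real.log ‖x‖ - u (b + (l ^ 2)⁻¹ • x) + 2 * Real.log l

/-- `z_{λ,b}(x) = |x|^{−μ} v(b + x/|x|²) − λ^{−μ} v(b + x/λ²)`. -/
noncomputable def zMS (n : ℕ) (μ : ℝ) (u : EuclideanSpace ℝ (Fin n) → ℝ)
    (b : EuclideanSpace ℝ (Fin n)) (l : ℝ) (x : EuclideanSpace ℝ (Fin n)) : ℝ :=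
  ‖x‖ ^ (-μ) * V n μ u (b + (‖x‖ ^ 2)⁻¹ • x) - l ^ (-μ) * V n μ u (b + (l ^ 2)⁻¹ • x)

/-- The critical moving-spheres radius `λ_b`. -/
noncomputable def lambdaB (n : ℕ) (μ : ℝ) (u : EuclideanSpace ℝ (Fin n) → ℝ)
    (b : EuclideanSpace ℝ (Fin n)) : ℝ :=
  sInf {l : ℝ | 0 < l ∧ ∀ ρ : ℝ, l ≤ ρ → ∀ x : EuclideanSpace ℝ (Fin n),
    0 < ‖x‖ → ‖x‖ < ρ → 0 ≤ wMS n u b ρ x ∧ 0 ≤ zMS n μ u b ρ x}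

section Riesz

open Set EuclideanGeometry Topology

variable {n : ℕ} {μ : ℝ}

local notation "𝔼" => EuclideanSpace ℝ (Fin n)

lemma integrableOn_ball_inv_norm_rpow (hn : 1 ≤ n) (hμn : μ < n) (r : ℝ) :
    IntegrableOn (fun y : 𝔼 => (‖y‖ ^ μ)⁻¹) (ball 0 r) := by
  refine integrableOn_ball_of_norm_le_rpow (C := 1) (α := μ) (by simpa using hn)
    (by simpa using hμn) (ae_of_all _ fun x => ?_) ?_
  · rw [Real.rpow_neg (norm_nonneg _), one_mul, Real.norm_of_nonneg (by positivity)]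
  · exact (by fun_prop : Measurable fun y : 𝔼 => (‖y‖ ^ μ)⁻¹).aestronglyMeasurable

lemma integrable_div_norm_rpow (hn : 1 ≤ n) (hμ0 : 0 < μ) (hμn : μ < n) {g : 𝔼 → ℝ}
    (hg : Continuous g) (hgi : Integrable g) (x : 𝔼) :
    Integrable fun y => g y / ‖x - y‖ ^ μ := by
  rw [← integrable_comp_sub_left _ x]
  simp only [sub_sub_cancel]
  rw [← integrableOn_univ, ← union_compl_self (ball (0 : 𝔼) 1)]
  refine IntegrableOn.union ?_ ?_
  · obtain ⟨M, hM⟩ := (isCompact_closedBall (0 : 𝔼) 1).exists_bound_of_continuousOn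
      (f := fun y => g (x - y)) (by fun_prop)
    simp only [div_eq_mul_inv]
    refine Integrable.bdd_mul (c := M) (integrableOn_ball_inv_norm_rpow hn hμn 1) ?_ ?_
    · exact (by fun_prop : Continuous fun y => g (x - y)).aestronglyMeasurable
    · filter_upwards [ae_restrict_mem measurableSet_ball] with y hy
      exact hM y (ball_subset_closedBall hy)
  · refine Integrable.mono' (((integrable_comp_sub_left g x).2 hgi).norm.integrableOn) ?_ ?_
    · have : Measurable g := hg.measurable
      exact (by fun_prop : Measurable fun y => g (x - y) / ‖y‖ ^ μ).aestronglyMeasurable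
    · filter_upwards [ae_restrict_mem measurableSet_ball.compl] with y hy
      simp only [mem_compl_iff, mem_ball, dist_zero_right, not_lt] at hy
      rw [norm_div, Real.norm_of_nonneg (by positivity : (0 : ℝ) ≤ ‖y‖ ^ μ)]
      exact div_le_self (norm_nonneg _) (Real.one_le_rpow hy hμ0.le)

lemma continuous_integral_div_norm_rpow (hn : 1 ≤ n) (hμ0 : 0 < μ) (hμn : μ < n) {g : 𝔼 → ℝ}
    (hg : Continuous g) (hgi : Integrable g) :
    Continuous fun x => ∫ y, g y / ‖x - y‖ ^ μ := by
  have hm : Measurable g := hg.measurable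
  set k₁ : 𝔼 → ℝ := (ball (0 : 𝔼) 1).indicator fun y => (‖y‖ ^ μ)⁻¹ - 1 with hk₁
  set k₂ : 𝔼 → ℝ := fun y => (max 1 ‖y‖ ^ μ)⁻¹ with hk₂
  have hk₁i : Integrable k₁ :=
    ((integrableOn_ball_inv_norm_rpow hn hμn 1).sub
      (integrableOn_const measure_ball_lt_top.ne)).integrable_indicator measurableSet_ball
  have hk : ∀ y, (‖y‖ ^ μ)⁻¹ = k₁ y + k₂ y := by
    intro y
    by_cases hy : ‖y‖ < 1
    · simp [hk₁, hk₂, hy, max_eq_left hy.le]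
    · simp [hk₁, hk₂, hy, max_eq_right (not_lt.1 hy)]
  have hk₂c : Continuous k₂ := by
    refine Continuous.inv₀ ?_ fun y => ?_
    · exact (continuous_const.max continuous_norm).rpow_const fun y => Or.inr hμ0.le
    · positivity
  have hk₂b : ∀ y, ‖k₂ y‖ ≤ 1 := by
    intro y
    rw [Real.norm_of_nonneg (by positivity)]
    exact inv_le_one_of_one_le₀ (Real.one_le_rpow (le_max_left _ _) hμ0.le)
  have hk₁0 : ∀ y, ¬ ‖y‖ < 1 → k₁ y = 0 := by
    intro y hy
    simp [hk₁, hy]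
  have hi₁ : ∀ x, Integrable fun y => g (x - y) * k₁ y := by
    intro x
    obtain ⟨M, hM⟩ := (isCompact_closedBall x 1).exists_bound_of_continuousOn hg.continuousOn
    refine Integrable.mono' (hk₁i.norm.const_mul M) ?_ (ae_of_all _ fun y => ?_)
    · exact (by fun_prop : Continuous fun y => g (x - y)).aestronglyMeasurable.mul
        hk₁i.aestronglyMeasurable
    · by_cases hy : ‖y‖ < 1
      · rw [norm_mul]
        gcongr
        exact hM _ (by simpa [mem_closedBall, dist_eq_norm] using hy.le)
      · simp [hk₁0 y hy]
  have hi₂ : ∀ x, Integrable fun y => g y * k₂ (x - y) := fun x =>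
    hgi.mul_bdd (c := 1) (by fun_prop : Continuous fun y => k₂ (x - y)).aestronglyMeasurable
      (ae_of_all _ fun y => hk₂b _)
  have hsplit : (fun x => ∫ y, g y / ‖x - y‖ ^ μ) =
      fun x => (∫ y, g (x - y) * k₁ y) + ∫ y, g y * k₂ (x - y) := by
    funext x
    have h1 : ∫ y, g (x - y) * k₁ y = ∫ y, g y * k₁ (x - y) := by
      rw [← integral_sub_left_eq_self (fun y => g y * k₁ (x - y)) volume x]
      simp
    have h2 : Integrable fun y => g y * k₁ (x - y) := by
      have := hi₁ x
      rw [← integrable_comp_sub_left _ x] at this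
      simpa using this
    rw [h1, ← integral_add h2 (hi₂ x)]
    congr 1 with y
    rw [div_eq_mul_inv, hk, mul_add]
  rw [hsplit]
  refine Continuous.add ?_ ?_
  · rw [continuous_iff_continuousAt]
    intro x₀
    obtain ⟨M, hM⟩ := (isCompact_closedBall x₀ 2).exists_bound_of_continuousOn hg.continuousOn
    refine continuousAt_of_dominated (bound := fun y => M * ‖k₁ y‖)
      (Eventually.of_forall fun x => (hi₁ x).aestronglyMeasurable) ?_ (hk₁i.norm.const_mul M)
      (ae_of_all _ fun y => by fun_prop)
    filter_upwards [ball_mem_nhds x₀ one_pos] with x hx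
    refine ae_of_all _ fun y => ?_
    by_cases hy : ‖y‖ < 1
    · rw [norm_mul]
      gcongr
      refine hM _ ?_
      rw [mem_ball, dist_eq_norm] at hx
      rw [mem_closedBall, dist_eq_norm, sub_right_comm]
      linarith [norm_sub_le (x - x₀) y]
    · simp [hk₁0 y hy]
  · refine continuous_of_dominated (bound := fun y => ‖g y‖)
      (fun x => (hi₂ x).aestronglyMeasurable) (fun x => ae_of_all _ fun y => ?_) hgi.norm
      (ae_of_all _ fun y => by fun_prop)
    rw [norm_mul]
    exact mul_le_of_le_one_right (norm_nonneg _) (hk₂b _)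

end Riesz

section Inversion

open Set EuclideanGeometry Topology

variable {n : ℕ} {μ : ℝ}

local notation "𝔼" => EuclideanSpace ℝ (Fin n)

lemma image_inversion_ball_diff_center (b : 𝔼) {r : ℝ} (hr : 0 < r) :
    inversion b r '' (ball b r \ {b}) = (closedBall b r)ᶜ := by
  ext y
  constructor
  · rintro ⟨x, ⟨hx, hxb⟩, rfl⟩
    have hd : 0 < dist x b := dist_pos.2 hxb
    rw [mem_ball] at hx
    rw [mem_compl_iff, mem_closedBall, dist_inversion_center, not_le, lt_div_iff₀ hd]
    nlinarith
  · intro hy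
    rw [mem_compl_iff, mem_closedBall, not_le] at hy
    have hd : 0 < dist y b := hr.trans hy
    refine ⟨inversion b r y, ⟨?_, ?_⟩, inversion_inversion b hr.ne' y⟩
    · rw [mem_ball, dist_inversion_center, div_lt_iff₀ hd]
      nlinarith
    · rw [mem_singleton_iff, inversion_eq_center hr.ne']
      exact dist_pos.1 hd

lemma abs_det_fderiv_inversion (b x : 𝔼) (r : ℝ) :
    |((r / dist x b) ^ 2 • ((ℝ ∙ (x - b))ᗮ.reflection : 𝔼 →L[ℝ] 𝔼)).det| =
      (r / dist x b) ^ (2 * n) := by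
  have h : ((r / dist x b) ^ 2 • ((ℝ ∙ (x - b))ᗮ.reflection : 𝔼 →L[ℝ] 𝔼)).det =
      LinearMap.det ((r / dist x b) ^ 2 • ((ℝ ∙ (x - b))ᗮ.reflection.toLinearMap)) := rfl
  rw [h, LinearMap.det_smul, Submodule.det_reflection, abs_mul, abs_pow, abs_pow, abs_pow, abs_neg,
    abs_one, one_pow, mul_one, sq_abs, ← pow_mul, finrank_euclideanSpace_fin]

lemma integrable_split_inversion (hn : 1 ≤ n) (b : 𝔼) {r : ℝ} (hr : 0 < r) {F : 𝔼 → ℝ}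
    (hF : Integrable F) :
    IntegrableOn (fun z => F z + (r / dist z b) ^ (2 * n) * F (inversion b r z))
        (ball b r \ {b}) ∧
      ∫ z, F z =
        ∫ z in ball b r \ {b}, (F z + (r / dist z b) ^ (2 * n) * F (inversion b r z)) := by
  have hnt : Nontrivial 𝔼 := Module.nontrivial_of_finrank_pos (R := ℝ) (by simp; lia)
  have hms : MeasurableSet (ball b r \ {b}) := measurableSet_ball.diff (measurableSet_singleton b)
  have hd : ∀ x ∈ ball b r \ {b}, HasFDerivWithinAt (inversion b r)
      ((r / dist x b) ^ 2 • ((ℝ ∙ (x - b))ᗮ.reflection : 𝔼 →L[ℝ] 𝔼)) (ball b r \ {b}) x :=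
    fun x hx => (hasFDerivAt_inversion hx.2).hasFDerivWithinAt
  have hinj : InjOn (inversion b r) (ball b r \ {b}) := (inversion_injective b hr.ne').injOn
  have h1 := integrableOn_image_iff_integrableOn_abs_det_fderiv_smul volume hms hd hinj F
  have h2 := integral_image_eq_integral_abs_det_fderiv_smul volume hms hd hinj F
  simp only [image_inversion_ball_diff_center b hr, abs_det_fderiv_inversion, smul_eq_mul]
    at h1 h2
  have h3 := h1.1 hF.integrableOn
  refine ⟨hF.integrableOn.add h3, ?_⟩
  rw [integral_add hF.integrableOn h3, ← h2, ← integral_add_compl measurableSet_closedBall hF]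
  congr 1
  refine setIntegral_congr_set ?_
  have h4 : (ball b r \ {b} : Set 𝔼) =ᵐ[volume] ball b r :=
    sdiff_null_ae_eq_self (measure_singleton b)
  refine EventuallyEq.trans ?_ h4.symm
  rw [← ball_union_sphere]
  exact union_ae_eq_left_of_ae_eq_empty
    (ae_eq_empty.2 (Measure.addHaar_sphere volume b r))

end Inversion

section Kernel

open Set EuclideanGeometry Topology

variable {n : ℕ} {μ : ℝ}

local notation "𝔼" => EuclideanSpace ℝ (Fin n)

/-- The distance from `y` to the mirror image of `z` in the sphere `∂B(b, r)`, scaled so that it is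
symmetric in `y`, `z` and agrees with `dist y z` on the sphere. -/
def reflDist (b : 𝔼) (r : ℝ) (y z : 𝔼) : ℝ :=
  dist z b * dist y (inversion b r z) / r

lemma reflDist_sq {b : 𝔼} {r : ℝ} (hr : 0 < r) (y : 𝔼) {z : 𝔼} (hz : z ≠ b) :
    reflDist b r y z ^ 2 =
      dist y z ^ 2 + (r ^ 2 - dist y b ^ 2) * (r ^ 2 - dist z b ^ 2) / r ^ 2 := by
  have hz' : 0 < ‖z - b‖ := norm_pos_iff.2 (sub_ne_zero.2 hz)
  have h1 : y - inversion b r z = (y - b) - (r / ‖z - b‖) ^ 2 • (z - b) := by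
    rw [inversion, dist_eq_norm, vsub_eq_sub, vadd_eq_add]
    abel
  have h2 : y - z = (y - b) - (z - b) := by abel
  rw [reflDist, dist_eq_norm y z, dist_eq_norm y (inversion b r z), dist_eq_norm, dist_eq_norm, h1,
    h2, div_pow, mul_pow, norm_sub_sq_real (y - b) ((r / _) ^ 2 • _), norm_sub_sq_real (y - b) (z - b),
    inner_smul_right, norm_smul,
    Real.norm_of_nonneg (by positivity)]
  field_simp
  ring

lemma dist_inversion_left {b : 𝔼} {r : ℝ} (hr : 0 < r) {y z : 𝔼} (hy : y ≠ b) (hz : z ≠ b) :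
    dist (inversion b r y) z = r * reflDist b r y z / dist y b := by
  have hy' : 0 < dist y b := dist_pos.2 hy
  have hz' : 0 < dist z b := dist_pos.2 hz
  conv_lhs => rw [← inversion_inversion b hr.ne' z]
  rw [dist_inversion_inversion hy ((inversion_eq_center hr.ne').not.2 hz), dist_inversion_center,
    reflDist]
  field_simp

lemma dist_inversion_right {b : 𝔼} {r : ℝ} (hr : 0 < r) (y : 𝔼) {z : 𝔼} (hz : z ≠ b) :
    dist y (inversion b r z) = r * reflDist b r y z / dist z b := by
  have hz' : 0 < dist z b := dist_pos.2 hz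
  rw [reflDist]
  field_simp

lemma reflDist_nonneg (b : 𝔼) {r : ℝ} (hr : 0 < r) (y z : 𝔼) : 0 ≤ reflDist b r y z := by
  unfold reflDist
  positivity

lemma dist_lt_reflDist {b : 𝔼} {r : ℝ} (hr : 0 < r) {y z : 𝔼} (hz : z ≠ b) (hyr : dist y b < r)
    (hzr : dist z b < r) : dist y z < reflDist b r y z := by
  refine lt_of_pow_lt_pow_left₀ 2 (reflDist_nonneg b hr y z) ?_
  rw [reflDist_sq hr y hz]
  have h1 : 0 < r ^ 2 - dist y b ^ 2 := by nlinarith [dist_nonneg (x := y) (y := b)]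
  have h2 : 0 < r ^ 2 - dist z b ^ 2 := by nlinarith [dist_nonneg (x := z) (y := b)]
  have : 0 < (r ^ 2 - dist y b ^ 2) * (r ^ 2 - dist z b ^ 2) / r ^ 2 := by positivity
  linarith

lemma reflDist_le {b : 𝔼} {r : ℝ} (hr : 0 < r) {y z : 𝔼} (hz : z ≠ b) (hyr : dist y b < r)
    (hzr : dist z b < r) : reflDist b r y z ≤ 2 * r := by
  have hz' : 0 < dist z b := dist_pos.2 hz
  have h : dist y (inversion b r z) ≤ dist y b + r ^ 2 / dist z b := by
    rw [dist_comm z b, ← dist_center_inversion b z r]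
    exact dist_triangle _ _ _
  rw [reflDist, div_le_iff₀ hr]
  calc dist z b * dist y (inversion b r z) ≤ dist z b * (dist y b + r ^ 2 / dist z b) := by gcongr
    _ = dist z b * dist y b + r ^ 2 := by field_simp
    _ ≤ 2 * r * r := by nlinarith [dist_nonneg (x := y) (y := b)]

/-- Away from the boundary, the reflected distance exceeds the distance by a definite factor. -/
lemma exists_dist_le_mul_reflDist {r s t : ℝ} (hs : s < r) (ht : t < r) (hs0 : 0 ≤ s)
    (ht0 : 0 ≤ t) :
    ∃ θ, 0 < θ ∧ θ < 1 ∧ ∀ (b y z : 𝔼), z ≠ b → dist y b ≤ s → dist z b ≤ t →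
      dist y z ≤ θ * reflDist b r y z := by
  have hr : 0 < r := by linarith
  set η := (r ^ 2 - s ^ 2) * (r ^ 2 - t ^ 2) / r ^ 2 with hη
  have h1 : 0 < r ^ 2 - s ^ 2 := by nlinarith
  have h2 : 0 < r ^ 2 - t ^ 2 := by nlinarith
  have hη0 : 0 < η := by positivity
  have hη1 : η ≤ r ^ 2 := by
    rw [hη, div_le_iff₀ (by positivity)]
    nlinarith [mul_nonneg (sq_nonneg s) h2.le, mul_nonneg (sq_nonneg r) (sq_nonneg t)]
  have hq : 0 < 1 - η / (2 * r) ^ 2 := by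
    rw [sub_pos, div_lt_one (by positivity)]
    nlinarith
  refine ⟨√(1 - η / (2 * r) ^ 2), Real.sqrt_pos.2 hq, ?_, fun b y z hz hy hzt => ?_⟩
  · rw [Real.sqrt_lt' one_pos]
    have : 0 < η / (2 * r) ^ 2 := by positivity
    linarith
  · refine le_of_sq_le_sq ?_ (by have := reflDist_nonneg b hr y z; positivity)
    have hD := reflDist_le hr hz (hy.trans_lt hs) (hzt.trans_lt ht)
    have hD0 := reflDist_nonneg b hr y z
    have hsq := reflDist_sq hr y hz
    rw [mul_pow, Real.sq_sqrt hq.le]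
    have h3 : η ≤ (r ^ 2 - dist y b ^ 2) * (r ^ 2 - dist z b ^ 2) / r ^ 2 := by
      have h5 : r ^ 2 - s ^ 2 ≤ r ^ 2 - dist y b ^ 2 := by gcongr
      have h6 : r ^ 2 - t ^ 2 ≤ r ^ 2 - dist z b ^ 2 := by gcongr
      rw [hη]
      exact div_le_div_of_nonneg_right (mul_le_mul h5 h6 h2.le (h1.le.trans h5)) (by positivity)
    have h4 : η / (2 * r) ^ 2 * reflDist b r y z ^ 2 ≤ η := by
      rw [div_mul_eq_mul_div, div_le_iff₀ (by positivity)]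
      gcongr
    linarith

end Kernel

section Density

open Set EuclideanGeometry Topology

variable {n : ℕ} {μ : ℝ} {u : EuclideanSpace ℝ (Fin n) → ℝ}

local notation "𝔼" => EuclideanSpace ℝ (Fin n)

/-- The weight `e^{((2n-μ)/2) u}`. -/
def weight (n : ℕ) (μ : ℝ) (u : EuclideanSpace ℝ (Fin n) → ℝ)
    (y : EuclideanSpace ℝ (Fin n)) : ℝ :=
  Real.exp ((2 * n - μ) / 2 * u y)

/-- The density `v e^{((2n-μ)/2) u}` of the measure whose logarithmic potential is `u`. -/
def curvDensity (n : ℕ) (μ : ℝ) (u : EuclideanSpace ℝ (Fin n) → ℝ)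
    (y : EuclideanSpace ℝ (Fin n)) : ℝ :=
  V n μ u y * weight n μ u y

lemma weight_pos (y : 𝔼) : 0 < weight n μ u y := Real.exp_pos _

lemma continuous_weight (hu : Continuous u) : Continuous (weight n μ u) := by
  unfold weight
  fun_prop

lemma integrable_weight (hB : CondB n μ u) : Integrable (weight n μ u) := hB.1

lemma integrable_weight_div (hn : 1 ≤ n) (hμ0 : 0 < μ) (hμn : μ < n) (hu : Continuous u)
    (hB : CondB n μ u) (x : 𝔼) : Integrable fun y => weight n μ u y / ‖x - y‖ ^ μ :=
  integrable_div_norm_rpow hn hμ0 hμn (continuous_weight hu) (integrable_weight hB) x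

lemma continuous_V (hn : 1 ≤ n) (hμ0 : 0 < μ) (hμn : μ < n) (hu : Continuous u)
    (hB : CondB n μ u) : Continuous (V n μ u) :=
  continuous_integral_div_norm_rpow hn hμ0 hμn (continuous_weight hu) (integrable_weight hB)

lemma V_pos (hn : 1 ≤ n) (hμ0 : 0 < μ) (hμn : μ < n) (hu : Continuous u)
    (hB : CondB n μ u) (x : 𝔼) : 0 < V n μ u x := by
  have hnt : Nontrivial 𝔼 := Module.nontrivial_of_finrank_pos (R := ℝ) (by simp; lia)
  refine (integral_pos_iff_support_of_nonneg
    (fun y => div_nonneg (weight_pos y).le (by positivity))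
    (integrable_weight_div hn hμ0 hμn hu hB x)).2 ?_
  have : ({x}ᶜ : Set 𝔼) ⊆ Function.support fun y => weight n μ u y / ‖x - y‖ ^ μ := by
    intro y hy
    have : 0 < ‖x - y‖ := norm_pos_iff.2 (sub_ne_zero.2 (Ne.symm hy))
    have := weight_pos (μ := μ) (u := u) y
    exact ne_of_gt (by positivity)
  refine lt_of_lt_of_le ?_ (measure_mono this)
  exact (isOpen_compl_singleton).measure_pos _ (nonempty_compl_of_nontrivial x)

lemma curvDensity_pos (hn : 1 ≤ n) (hμ0 : 0 < μ) (hμn : μ < n) (hu : Continuous u)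
    (hB : CondB n μ u) (x : 𝔼) : 0 < curvDensity n μ u x :=
  mul_pos (V_pos hn hμ0 hμn hu hB x) (weight_pos x)

lemma continuous_curvDensity (hn : 1 ≤ n) (hμ0 : 0 < μ) (hμn : μ < n) (hu : Continuous u)
    (hB : CondB n μ u) : Continuous (curvDensity n μ u) :=
  (continuous_V hn hμ0 hμn hu hB).mul (continuous_weight hu)

lemma integrable_curvDensity (hB : CondB n μ u) : Integrable (curvDensity n μ u) := by
  have h := Integrable.integral_prod_left (μ := volume) (ν := volume) hB.2
  refine h.congr (ae_of_all _ fun x => ?_)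
  simp only [mul_div_assoc]
  rw [integral_const_mul, mul_comm]
  rfl

lemma log_inv_le_inv_rpow_div (hμ0 : 0 < μ) {d : ℝ} (hd : 0 ≤ d) :
    Real.log d⁻¹ ≤ (d ^ μ)⁻¹ / μ := by
  rw [← Real.inv_rpow hd]
  exact Real.log_le_rpow_div (by positivity) hμ0

lemma log_kernel_le (hμ0 : 0 < μ) {x z : 𝔼} (hxz : x ≠ z) :
    Real.log ((‖z‖ + 1) / ‖x - z‖) ≤
      Real.log (‖x‖ + 2) + (ball (0 : 𝔼) 1).indicator (fun y => (‖y‖ ^ μ)⁻¹) (x - z) / μ := by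
  have hd : 0 < ‖x - z‖ := norm_pos_iff.2 (sub_ne_zero.2 hxz)
  have h1 : ‖z‖ ≤ ‖x - z‖ + ‖x‖ := by
    have := norm_sub_le x (x - z)
    rw [sub_sub_cancel] at this
    linarith
  by_cases h : ‖x - z‖ < 1
  · rw [indicator_of_mem (by simpa using h), div_eq_mul_inv, Real.log_mul (by positivity)
      (by positivity)]
    have := log_inv_le_inv_rpow_div hμ0 hd.le
    have : Real.log (‖z‖ + 1) ≤ Real.log (‖x‖ + 2) :=
      Real.log_le_log (by positivity) (by linarith)
    linarith
  · rw [indicator_of_notMem (by simpa using h), zero_div, add_zero]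
    refine Real.log_le_log (by positivity) ?_
    rw [div_le_iff₀ hd]
    nlinarith [norm_nonneg x]

lemma neg_log_kernel_le {x z : 𝔼} (hxz : x ≠ z) :
    -Real.log ((‖z‖ + 1) / ‖x - z‖) ≤ Real.log (‖x‖ + 2) := by
  have hd : 0 < ‖x - z‖ := norm_pos_iff.2 (sub_ne_zero.2 hxz)
  rw [← Real.log_inv, inv_div]
  refine Real.log_le_log (by positivity) ?_
  rw [div_le_iff₀ (by positivity)]
  nlinarith [norm_sub_le x z, norm_nonneg x, norm_nonneg z, mul_nonneg (norm_nonneg x) (norm_nonneg z)]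

lemma ae_ne_point (hn : 1 ≤ n) (x : 𝔼) : ∀ᵐ z : 𝔼, z ≠ x := by
  have hnt : Nontrivial 𝔼 := Module.nontrivial_of_finrank_pos (R := ℝ) (by simp; lia)
  simp [ae_iff]

lemma integrable_log_kernel (hn : 1 ≤ n) (hμ0 : 0 < μ) (hμn : μ < n) (hu : Continuous u)
    (hB : CondB n μ u) (x : 𝔼) :
    Integrable fun z => Real.log ((‖z‖ + 1) / ‖x - z‖) * curvDensity n μ u z := by
  have hc := continuous_curvDensity hn hμ0 hμn hu hB
  have hi := integrable_curvDensity hB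
  have hm := hc.measurable
  have h1 := integrable_div_norm_rpow hn hμ0 hμn hc hi x
  refine Integrable.mono' ((hi.const_mul (Real.log (‖x‖ + 2))).add (h1.div_const μ)) ?_ ?_
  · exact (by fun_prop : Measurable fun z =>
      Real.log ((‖z‖ + 1) / ‖x - z‖) * curvDensity n μ u z).aestronglyMeasurable
  · filter_upwards [ae_ne_point hn x] with z hz
    have hp := curvDensity_pos hn hμ0 hμn hu hB z
    have ha : |Real.log ((‖z‖ + 1) / ‖x - z‖)| ≤ Real.log (‖x‖ + 2) + (‖x - z‖ ^ μ)⁻¹ / μ := by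
      have h2 : (ball (0 : 𝔼) 1).indicator (fun y => (‖y‖ ^ μ)⁻¹) (x - z) / μ ≤
          (‖x - z‖ ^ μ)⁻¹ / μ := by
        gcongr
        exact indicator_le_self' (fun _ _ => by positivity) _
      rw [abs_le]
      constructor
      · have : 0 ≤ (‖x - z‖ ^ μ)⁻¹ / μ := by positivity
        linarith [neg_log_kernel_le hz.symm]
      · linarith [log_kernel_le hμ0 hz.symm]
    rw [norm_mul, Real.norm_of_nonneg hp.le, Real.norm_eq_abs]
    calc _ ≤ (Real.log (‖x‖ + 2) + (‖x - z‖ ^ μ)⁻¹ / μ) * curvDensity n μ u z := by gcongr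
      _ = _ := by simp only [Pi.add_apply]; ring

lemma betaN_pos (hn : 1 ≤ n) : 0 < betaN n := by
  have h1 : 0 < (n : ℝ) := by exact_mod_cast hn
  have h2 : 0 < (volume (ball (0 : 𝔼) 1)).toReal :=
    ENNReal.toReal_pos (measure_ball_pos volume _ one_pos).ne' measure_ball_lt_top.ne
  have h3 := Real.Gamma_pos_of_pos (by positivity : 0 < (n : ℝ) / 2 + 1)
  have h4 := Real.Gamma_pos_of_pos (by positivity : 0 < (n : ℝ) / 2)
  unfold betaN
  positivity

lemma IE.sub_eq (hn : 1 ≤ n) (hμ0 : 0 < μ) (hμn : μ < n) (hu : Continuous u)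
    (hB : CondB n μ u) (hIE : IE n μ u) (x y : 𝔼) :
    Integrable (fun z => Real.log (dist y z / dist x z) * curvDensity n μ u z) ∧
      u x - u y = 1 / betaN n * ∫ z, Real.log (dist y z / dist x z) * curvDensity n μ u z := by
  obtain ⟨C, hC⟩ := hIE
  have hx := integrable_log_kernel hn hμ0 hμn hu hB x
  have hy := integrable_log_kernel hn hμ0 hμn hu hB y
  have he : (fun z => Real.log ((‖z‖ + 1) / ‖x - z‖) * curvDensity n μ u z -
      Real.log ((‖z‖ + 1) / ‖y - z‖) * curvDensity n μ u z) =ᵐ[volume]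
      fun z => Real.log (dist y z / dist x z) * curvDensity n μ u z := by
    filter_upwards [ae_ne_point hn x, ae_ne_point hn y] with z hzx hzy
    have h1 : 0 < ‖x - z‖ := norm_pos_iff.2 (sub_ne_zero.2 hzx.symm)
    have h2 : 0 < ‖y - z‖ := norm_pos_iff.2 (sub_ne_zero.2 hzy.symm)
    rw [dist_eq_norm, dist_eq_norm, Real.log_div (by positivity) h1.ne',
      Real.log_div (by positivity) h2.ne', Real.log_div h2.ne' h1.ne']
    ring
  refine ⟨(hx.sub hy).congr he, ?_⟩
  rw [← integral_congr_ae he, integral_sub hx hy, hC x, hC y]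
  simp only [curvDensity, weight]
  ring

lemma alphaC_eq : alphaC n μ u = 1 / betaN n * ∫ z, curvDensity n μ u z := rfl

end Density

section Gap

open Set EuclideanGeometry Topology

variable {n : ℕ} {μ : ℝ} {u : EuclideanSpace ℝ (Fin n) → ℝ}

local notation "𝔼" => EuclideanSpace ℝ (Fin n)

/-- The difference between the conformal reflection of `u` in the sphere `∂B(b, r)` and `u`. -/
def reflGap (u : 𝔼 → ℝ) (b : 𝔼) (r : ℝ) (y : 𝔼) : ℝ :=
  u (inversion b r y) - u y - 2 * Real.log (dist y b / r)

/-- The difference between the Kelvin transform of `v` in the sphere `∂B(b, r)` and `v`. -/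
def kelvinGap (n : ℕ) (μ : ℝ) (u : EuclideanSpace ℝ (Fin n) → ℝ) (b : EuclideanSpace ℝ (Fin n))
    (r : ℝ) (y : EuclideanSpace ℝ (Fin n)) : ℝ :=
  (r / dist y b) ^ μ * V n μ u (inversion b r y) - V n μ u y

/-- The difference between the reflected curvature density and the curvature density. -/
def curvGap (n : ℕ) (μ : ℝ) (u : EuclideanSpace ℝ (Fin n) → ℝ) (b : EuclideanSpace ℝ (Fin n))
    (r : ℝ) (y : EuclideanSpace ℝ (Fin n)) : ℝ :=
  weight n μ u y * ((V n μ u y + kelvinGap n μ u b r y) *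
    Real.exp ((2 * n - μ) / 2 * reflGap u b r y) - V n μ u y)

lemma weight_inversion {b : 𝔼} {r : ℝ} (hr : 0 < r) {z : 𝔼} (hz : z ≠ b) :
    (r / dist z b) ^ (2 * n) * ((dist z b / r) ^ μ * weight n μ u (inversion b r z)) =
      weight n μ u z * Real.exp ((2 * n - μ) / 2 * reflGap u b r z) := by
  have hz' : 0 < dist z b := dist_pos.2 hz
  have h1 : (r / dist z b) ^ (2 * n) = Real.exp (-(2 * n) * Real.log (dist z b / r)) := by
    rw [← inv_div, inv_pow, neg_mul, Real.exp_neg]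
    congr 1
    rw [mul_comm (2 * (n : ℝ)), ← Real.rpow_def_of_pos (by positivity), ← Real.rpow_natCast]
    push_cast
    rfl
  rw [h1, Real.rpow_def_of_pos (by positivity), weight, weight, reflGap, ← Real.exp_add,
    ← Real.exp_add, ← Real.exp_add]
  congr 1
  ring

lemma curvGap_eq {b : 𝔼} {r : ℝ} (hr : 0 < r) {z : 𝔼} (hz : z ≠ b) :
    curvGap n μ u b r z =
      (r / dist z b) ^ (2 * n) * curvDensity n μ u (inversion b r z) - curvDensity n μ u z := by
  have hz' : 0 < dist z b := dist_pos.2 hz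
  have h := weight_inversion (μ := μ) (u := u) hr hz
  have h2 : (r / dist z b) ^ μ * (dist z b / r) ^ μ = 1 := by
    rw [← Real.mul_rpow (by positivity) (by positivity)]
    field_simp
    simp
  rw [curvGap, kelvinGap, curvDensity, curvDensity, mul_sub, mul_left_comm, ← h]
  linear_combination (r / dist z b) ^ (2 * n) * V n μ u (inversion b r z) *
    weight n μ u (inversion b r z) * h2

lemma measurableSet_punctured_ball (b : 𝔼) (r : ℝ) : MeasurableSet (ball b r \ {b}) :=
  measurableSet_ball.diff (measurableSet_singleton b)

lemma ae_mem_punctured_ball_ne (hn : 1 ≤ n) (b y : 𝔼) (r : ℝ) :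
    ∀ᵐ z ∂(volume.restrict (ball b r \ {b})), z ∈ ball b r \ {b} ∧ z ≠ y :=
  (ae_restrict_mem (measurableSet_punctured_ball b r)).and (ae_restrict_of_ae (ae_ne_point hn y))

lemma reflGap_eq (hn : 1 ≤ n) (hμ0 : 0 < μ) (hμn : μ < n) (hu : Continuous u)
    (hB : CondB n μ u) (hIE : IE n μ u) {b : 𝔼} {r : ℝ} (hr : 0 < r) {y : 𝔼}
    (hy : y ∈ ball b r \ {b}) :
    IntegrableOn (fun z => Real.log (reflDist b r y z / dist y z) * curvGap n μ u b r z)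
        (ball b r \ {b}) ∧
      reflGap u b r y = 1 / betaN n * (∫ z in ball b r \ {b},
        Real.log (reflDist b r y z / dist y z) * curvGap n μ u b r z) +
        (alphaC n μ u - 2) * Real.log (dist y b / r) := by
  obtain ⟨h1, h2⟩ := hIE.sub_eq hn hμ0 hμn hu hB (inversion b r y) y
  obtain ⟨h3, h4⟩ := integrable_split_inversion hn b hr h1
  obtain ⟨h5, h6⟩ := integrable_split_inversion hn b hr (integrable_curvDensity hB)
  have he : (fun z => (Real.log (dist y z / dist (inversion b r y) z) * curvDensity n μ u z +
        (r / dist z b) ^ (2 * n) *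
          (Real.log (dist y (inversion b r z) / dist (inversion b r y) (inversion b r z)) *
            curvDensity n μ u (inversion b r z))) - Real.log (dist y b / r) *
          (curvDensity n μ u z + (r / dist z b) ^ (2 * n) * curvDensity n μ u (inversion b r z)))
      =ᵐ[volume.restrict (ball b r \ {b})]
      fun z => Real.log (reflDist b r y z / dist y z) * curvGap n μ u b r z := by
    filter_upwards [ae_mem_punctured_ball_ne hn b y r] with z hz
    obtain ⟨⟨hzr, hzb⟩, hzy⟩ := hz
    have hyb' : 0 < dist y b := dist_pos.2 hy.2
    have hzb' : 0 < dist z b := dist_pos.2 hzb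
    have hd : 0 < dist y z := dist_pos.2 hzy.symm
    have hD : 0 < reflDist b r y z := hd.trans (dist_lt_reflDist hr hzb hy.1 hzr)
    have e1 : dist y z / dist (inversion b r y) z =
        (dist y b / r) * (reflDist b r y z / dist y z)⁻¹ := by
      rw [dist_inversion_left hr hy.2 hzb]
      field_simp
    have e2 : dist y (inversion b r z) / dist (inversion b r y) (inversion b r z) =
        (dist y b / r) * (reflDist b r y z / dist y z) := by
      rw [dist_inversion_right hr y hzb, dist_inversion_inversion hy.2 hzb]
      field_simp
    rw [e1, e2, Real.log_mul (by positivity) (by positivity),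
      Real.log_mul (by positivity) (by positivity), Real.log_inv, curvGap_eq hr hzb]
    ring
  refine ⟨(h3.sub (h5.const_mul _)).congr he, ?_⟩
  rw [← integral_congr_ae he, integral_sub h3 (h5.const_mul _), ← h4, integral_const_mul, ← h6,
    reflGap, h2, alphaC_eq]
  ring

lemma kelvinGap_eq (hn : 1 ≤ n) (hμ0 : 0 < μ) (hμn : μ < n) (hu : Continuous u)
    (hB : CondB n μ u) {b : 𝔼} {r : ℝ} (hr : 0 < r) {y : 𝔼} (hy : y ∈ ball b r \ {b}) :
    IntegrableOn (fun z => ((dist y z ^ μ)⁻¹ - (reflDist b r y z ^ μ)⁻¹) *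
        (weight n μ u z * (Real.exp ((2 * n - μ) / 2 * reflGap u b r z) - 1)))
        (ball b r \ {b}) ∧
      kelvinGap n μ u b r y = ∫ z in ball b r \ {b},
        ((dist y z ^ μ)⁻¹ - (reflDist b r y z ^ μ)⁻¹) *
        (weight n μ u z * (Real.exp ((2 * n - μ) / 2 * reflGap u b r z) - 1)) := by
  have i1 := (integrable_weight_div hn hμ0 hμn hu hB (inversion b r y)).const_mul
    ((r / dist y b) ^ μ)
  have i2 := integrable_weight_div hn hμ0 hμn hu hB y
  obtain ⟨h3, h4⟩ := integrable_split_inversion hn b hr (i1.sub i2)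
  have he : (fun z => ((r / dist y b) ^ μ * (weight n μ u z / ‖inversion b r y - z‖ ^ μ) -
        weight n μ u z / ‖y - z‖ ^ μ) + (r / dist z b) ^ (2 * n) *
        ((r / dist y b) ^ μ * (weight n μ u (inversion b r z) /
          ‖inversion b r y - inversion b r z‖ ^ μ) -
        weight n μ u (inversion b r z) / ‖y - inversion b r z‖ ^ μ))
      =ᵐ[volume.restrict (ball b r \ {b})]
      fun z => ((dist y z ^ μ)⁻¹ - (reflDist b r y z ^ μ)⁻¹) *
        (weight n μ u z * (Real.exp ((2 * n - μ) / 2 * reflGap u b r z) - 1)) := by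
    filter_upwards [ae_mem_punctured_ball_ne hn b y r] with z hz
    obtain ⟨⟨hzr, hzb⟩, hzy⟩ := hz
    have hyb' : 0 < dist y b := dist_pos.2 hy.2
    have hzb' : 0 < dist z b := dist_pos.2 hzb
    have hd : 0 < dist y z := dist_pos.2 hzy.symm
    have hD : 0 < reflDist b r y z := hd.trans (dist_lt_reflDist hr hzb hy.1 hzr)
    have h := weight_inversion (μ := μ) (u := u) hr hzb
    have e1 : (r / dist y b) ^ μ * (weight n μ u z / ‖inversion b r y - z‖ ^ μ) =
        weight n μ u z * (reflDist b r y z ^ μ)⁻¹ := by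
      rw [← dist_eq_norm, dist_inversion_left hr hy.2 hzb, mul_div_assoc',
        mul_comm _ (weight n μ u z), mul_div_assoc, ← Real.div_rpow (by positivity) (by positivity),
        ← Real.inv_rpow (by positivity)]
      congr 2
      field_simp
    have e2 : (r / dist y b) ^ μ * (weight n μ u (inversion b r z) /
        ‖inversion b r y - inversion b r z‖ ^ μ) =
        (dist z b / r) ^ μ * weight n μ u (inversion b r z) * (dist y z ^ μ)⁻¹ := by
      rw [← dist_eq_norm, dist_inversion_inversion hy.2 hzb, mul_div_assoc',
        mul_comm _ (weight n μ u _), mul_div_assoc, ← Real.div_rpow (by positivity) (by positivity),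
        ← Real.inv_rpow (by positivity), mul_comm _ (weight n μ u _), mul_assoc,
        ← Real.mul_rpow (by positivity) (by positivity)]
      congr 2
      field_simp
    have e3 : weight n μ u (inversion b r z) / ‖y - inversion b r z‖ ^ μ =
        (dist z b / r) ^ μ * weight n μ u (inversion b r z) * (reflDist b r y z ^ μ)⁻¹ := by
      rw [← dist_eq_norm, dist_inversion_right hr y hzb, mul_comm _ (weight n μ u _), mul_assoc,
        ← Real.inv_rpow (by positivity), ← Real.mul_rpow (by positivity) (by positivity),
        div_eq_mul_inv, ← Real.inv_rpow (by positivity)]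
      congr 2
      field_simp
    rw [e1, e2, e3, ← dist_eq_norm]
    linear_combination ((dist y z ^ μ)⁻¹ - (reflDist b r y z ^ μ)⁻¹) * h
  refine ⟨h3.congr he, ?_⟩
  rw [← integral_congr_ae he]
  refine Eq.trans ?_ h4
  rw [integral_sub' i1 i2, integral_const_mul]
  rfl

end Gap

section Mass

open Set EuclideanGeometry Topology

variable {n : ℕ} {μ : ℝ} {u : EuclideanSpace ℝ (Fin n) → ℝ}

local notation "𝔼" => EuclideanSpace ℝ (Fin n)

lemma exists_norm_ge_le_one (hn : 1 ≤ n) {I : 𝔼 → ℝ} (hI : Integrable I) (R : ℝ) :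
    ∃ x : 𝔼, R ≤ ‖x‖ ∧ I x ≤ 1 := by
  by_contra! h
  have hnt : Nontrivial 𝔼 := Module.nontrivial_of_finrank_pos (R := ℝ) (by simp; lia)
  have h1 : volume {x | 1 ≤ ‖I x‖} < ⊤ := hI.measure_norm_ge_lt_top one_pos
  have h2 : (univ : Set 𝔼) ⊆ ball 0 R ∪ {x | 1 ≤ ‖I x‖} := by
    intro x _
    by_cases hx : ‖x‖ < R
    · exact Or.inl (by simpa using hx)
    · exact Or.inr ((h x (not_lt.1 hx)).le.trans (le_abs_self _))
  have h3 := (measure_mono (μ := volume) h2).trans (measure_union_le _ _)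
  rw [measure_univ_of_isAddLeftInvariant] at h3
  exact absurd h3 (not_le.2 (ENNReal.add_lt_top.2 ⟨measure_ball_lt_top, h1⟩))

lemma exists_neg_two_log_le (hu : Continuous u) {b : 𝔼} {r : ℝ} (hr : 0 < r)
    (h : ∀ y ∈ ball b r \ {b}, 0 ≤ reflGap u b r y) :
    ∃ C R, ∀ x : 𝔼, R ≤ ‖x‖ → -2 * Real.log ‖x‖ - C ≤ u x := by
  obtain ⟨M, hM⟩ := (isCompact_closedBall b r).exists_bound_of_continuousOn hu.continuousOn
  refine ⟨M + 2 * Real.log (2 / r), ‖b‖ + r + 1, fun x hx => ?_⟩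
  have hd1 : ‖x‖ - ‖b‖ ≤ dist x b := by
    rw [dist_eq_norm]
    exact norm_sub_norm_le _ _
  have hd2 : dist x b ≤ ‖x‖ + ‖b‖ := by
    rw [dist_eq_norm]
    exact norm_sub_le _ _
  have hxb : 0 < dist x b := by linarith
  have hx0 : 0 < ‖x‖ := by linarith [norm_nonneg b]
  have hy : inversion b r x ∈ ball b r \ {b} := by
    refine ⟨?_, ?_⟩
    · rw [mem_ball, dist_inversion_center, div_lt_iff₀ hxb]
      nlinarith
    · rw [mem_singleton_iff, inversion_eq_center hr.ne']
      exact dist_pos.1 hxb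
  have h1 := h _ hy
  have h2 := hM _ (ball_subset_closedBall hy.1)
  rw [reflGap, inversion_inversion b hr.ne', dist_inversion_center] at h1
  have h3 : Real.log (r ^ 2 / dist x b / r) = -Real.log (dist x b / r) := by
    rw [← Real.log_inv]
    congr 1
    field_simp
  have h4 : Real.log (dist x b / r) ≤ Real.log ‖x‖ + Real.log (2 / r) := by
    rw [← Real.log_mul hx0.ne' (by positivity)]
    refine Real.log_le_log (by positivity) ?_
    rw [mul_div_assoc']
    gcongr
    linarith
  rw [h3] at h1
  rw [Real.norm_eq_abs] at h2
  linarith [neg_abs_le (u (inversion b r x))]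

lemma alphaC_le_two (hn : 1 ≤ n) (hμ0 : 0 < μ) (hμn : μ < n) (hu : Continuous u)
    (hB : CondB n μ u) (hIE : IE n μ u) {b : 𝔼} {r : ℝ} (hr : 0 < r)
    (h : ∀ y ∈ ball b r \ {b}, 0 ≤ reflGap u b r y) : alphaC n μ u ≤ 2 := by
  by_contra! hα
  have hβ := betaN_pos hn
  have hm := integrable_curvDensity hB
  have hmc := continuous_curvDensity hn hμ0 hμn hu hB
  have hmp := curvDensity_pos hn hμ0 hμn hu hB
  set m := curvDensity n μ u
  set a := ∫ z, m z with ha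
  have hβa : 2 * betaN n < a := by
    rw [alphaC_eq, one_div, inv_mul_eq_div, lt_div_iff₀ hβ] at hα
    exact hα
  have hlim : Tendsto (fun M : ℝ => ∫ z in closedBall (0 : 𝔼) M, m z) atTop (𝓝 a) :=
    (aecover_closedBall tendsto_id).integral_tendsto_of_countably_generated hm
  obtain ⟨M, hMa, hM0⟩ := ((hlim.eventually (lt_mem_nhds (show (a + 2 * betaN n) / 2 < a by
    linarith))).and (eventually_ge_atTop (0 : ℝ))).exists
  set aM := ∫ z in closedBall (0 : 𝔼) M, m z with haM
  obtain ⟨C₀, hC₀⟩ := hIE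
  obtain ⟨C₁, R₁, hC₁⟩ := exists_neg_two_log_le hu hr h
  set k : 𝔼 → ℝ := (ball (0 : 𝔼) 1).indicator fun y => (‖y‖ ^ μ)⁻¹ with hk
  have hki : Integrable k :=
    (integrableOn_ball_inv_norm_rpow hn hμn 1).integrable_indicator measurableSet_ball
  have hkm : Measurable k :=
    (by fun_prop : Measurable fun y : 𝔼 => (‖y‖ ^ μ)⁻¹).indicator measurableSet_ball
  have hI : Integrable fun x => ∫ z, m z * k (x - z) :=
    hm.integrable_convolution (ContinuousLinearMap.mul ℝ ℝ) hki
  have hIx : ∀ x, Integrable fun z => m z * k (x - z) := by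
    intro x
    have hm' := hmc.measurable
    refine (integrable_div_norm_rpow hn hμ0 hμn hmc hm x).mono'
      (by fun_prop : Measurable fun z => m z * k (x - z)).aestronglyMeasurable
      (ae_of_all _ fun z => ?_)
    have hk0 : 0 ≤ k (x - z) := indicator_nonneg (fun y _ => by positivity) _
    rw [Real.norm_of_nonneg (mul_nonneg (hmp z).le hk0), div_eq_mul_inv]
    exact mul_le_mul_of_nonneg_left (indicator_le_self' (fun _ _ => by positivity) _) (hmp z).le
  set γ := (2 * aM - a) / betaN n with hγ
  have hγ2 : 2 < γ := by
    rw [hγ, lt_div_iff₀ hβ]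
    linarith
  set c := Real.log (M + 1) + Real.log 2 with hc
  set C₂ := (c * a + 1 / μ) / betaN n + C₀ with hC₂
  obtain ⟨x, hxR, hxI⟩ := exists_norm_ge_le_one hn hI
    (max (max R₁ (2 * M + 2)) (Real.exp ((C₁ + C₂ + 1) / (γ - 2))))
  have hx1 : R₁ ≤ ‖x‖ := (le_max_left _ _).trans ((le_max_left _ _).trans hxR)
  have hx2 : 2 * M + 2 ≤ ‖x‖ := (le_max_right _ _).trans ((le_max_left _ _).trans hxR)
  have hx3 : Real.exp ((C₁ + C₂ + 1) / (γ - 2)) ≤ ‖x‖ := (le_max_right _ _).trans hxR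
  have hx0 : 0 < ‖x‖ := by linarith
  have hlog : C₁ + C₂ + 1 ≤ (γ - 2) * Real.log ‖x‖ := by
    rw [mul_comm, ← div_le_iff₀ (by linarith)]
    exact (Real.le_log_iff_exp_le hx0).2 hx3
  have hker : ∀ᵐ z : 𝔼, Real.log ((‖z‖ + 1) / ‖x - z‖) * m z ≤
      (c + Real.log ‖x‖) * m z -
        2 * Real.log ‖x‖ * (closedBall (0 : 𝔼) M).indicator m z + 1 / μ * (m z * k (x - z)) := by
    filter_upwards [ae_ne_point hn x] with z hz
    have hd : 0 < ‖x - z‖ := norm_pos_iff.2 (sub_ne_zero.2 hz.symm)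
    have hk0 : 0 ≤ k (x - z) := indicator_nonneg (fun y _ => by positivity) _
    have hM1 : 0 ≤ Real.log (M + 1) := Real.log_nonneg (by linarith)
    by_cases hzM : ‖z‖ ≤ M
    · rw [indicator_of_mem (by simpa using hzM)]
      have h1 : Real.log ((‖z‖ + 1) / ‖x - z‖) ≤ c - Real.log ‖x‖ := by
        rw [hc, ← Real.log_mul (by positivity) two_ne_zero, ← Real.log_div (by positivity) hx0.ne']
        refine Real.log_le_log (by positivity) ?_
        rw [div_le_div_iff₀ hd hx0]
        have := norm_sub_norm_le x z
        nlinarith [norm_nonneg z]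
      have h2 := mul_le_mul_of_nonneg_right h1 (hmp z).le
      have h3 : 0 ≤ 1 / μ * (m z * k (x - z)) := by
        have := (hmp z).le
        positivity
      linarith
    · rw [indicator_of_notMem (by simpa using hzM)]
      have h1 := log_kernel_le hμ0 hz.symm
      have h4 : Real.log (‖x‖ + 2) ≤ Real.log 2 + Real.log ‖x‖ := by
        rw [← Real.log_mul two_ne_zero hx0.ne']
        exact Real.log_le_log (by positivity) (by linarith)
      have h2 : Real.log ((‖z‖ + 1) / ‖x - z‖) ≤ c + Real.log ‖x‖ + k (x - z) / μ := by
        linarith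
      have h3 := mul_le_mul_of_nonneg_right h2 (hmp z).le
      calc _ ≤ _ := h3
        _ = _ := by ring
  have hind : Integrable ((closedBall (0 : 𝔼) M).indicator m) :=
    hm.indicator measurableSet_closedBall
  have hint : ∫ z, Real.log ((‖z‖ + 1) / ‖x - z‖) * m z ≤
      c * a + 1 / μ - betaN n * γ * Real.log ‖x‖ := by
    refine (integral_mono_ae (integrable_log_kernel hn hμ0 hμn hu hB x)
      (((hm.const_mul _).sub (hind.const_mul _)).add ((hIx x).const_mul _)) hker).trans ?_
    rw [integral_add' ((hm.const_mul _).sub (hind.const_mul _)) ((hIx x).const_mul _),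
      integral_sub' (hm.const_mul _) (hind.const_mul _), integral_const_mul, integral_const_mul,
      integral_const_mul, integral_indicator measurableSet_closedBall]
    have h1 : betaN n * γ = 2 * aM - a := by
      rw [hγ]
      field_simp
    have h2 : 1 / μ * (∫ z, m z * k (x - z)) ≤ 1 / μ * 1 := by gcongr
    rw [h1]
    linarith
  have hux : u x ≤ C₂ - γ * Real.log ‖x‖ := by
    have h1 : u x = 1 / betaN n * (∫ z, Real.log ((‖z‖ + 1) / ‖x - z‖) * m z) + C₀ := hC₀ x
    have h2 := mul_le_mul_of_nonneg_left hint (one_div_pos.2 hβ).le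
    have h3 : 1 / betaN n * (c * a + 1 / μ - betaN n * γ * Real.log ‖x‖) + C₀ =
        C₂ - γ * Real.log ‖x‖ := by
      rw [hC₂]
      field_simp
      ring
    linarith
  have := hC₁ x hx1
  linarith

end Mass

section StrictPositivity

open Set EuclideanGeometry Topology

variable {n : ℕ} {μ : ℝ} {u : EuclideanSpace ℝ (Fin n) → ℝ}

local notation "𝔼" => EuclideanSpace ℝ (Fin n)

/-- Nonnegativity of both gaps in the punctured ball. -/
def GapsNonneg (n : ℕ) (μ : ℝ) (u : EuclideanSpace ℝ (Fin n) → ℝ) (b : EuclideanSpace ℝ (Fin n))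
    (r : ℝ) : Prop :=
  ∀ y ∈ ball b r \ {b}, 0 ≤ reflGap u b r y ∧ 0 ≤ kelvinGap n μ u b r y

lemma continuousAt_inversion {b : 𝔼} {r : ℝ} {y : 𝔼} (hy : y ≠ b) :
    ContinuousAt (fun q : ℝ × 𝔼 => inversion b q.1 q.2) (r, y) :=
  continuousAt_const.inversion continuousAt_fst continuousAt_snd hy

lemma continuousAt_reflGap (hu : Continuous u) {b : 𝔼} {r : ℝ} (hr : 0 < r) {y : 𝔼} (hy : y ≠ b) :
    ContinuousAt (fun q : ℝ × 𝔼 => reflGap u b q.1 q.2) (r, y) := by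
  have hd : 0 < dist y b := dist_pos.2 hy
  refine ((hu.continuousAt.comp (continuousAt_inversion hy)).sub
    (hu.continuousAt.comp continuousAt_snd)).sub (continuousAt_const.mul ?_)
  refine ContinuousAt.log ((continuousAt_snd.dist continuousAt_const).div continuousAt_fst hr.ne') ?_
  exact (div_pos hd hr).ne'

lemma continuousAt_kelvinGap (hn : 1 ≤ n) (hμ0 : 0 < μ) (hμn : μ < n) (hu : Continuous u)
    (hB : CondB n μ u) {b : 𝔼} {r : ℝ} {y : 𝔼} (hy : y ≠ b) :
    ContinuousAt (fun q : ℝ × 𝔼 => kelvinGap n μ u b q.1 q.2) (r, y) := by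
  have hd : 0 < dist y b := dist_pos.2 hy
  have hV := continuous_V hn hμ0 hμn hu hB
  refine ContinuousAt.sub (ContinuousAt.mul ?_
    (hV.continuousAt.comp (continuousAt_inversion hy))) (hV.continuousAt.comp continuousAt_snd)
  exact (continuousAt_fst.div (continuousAt_snd.dist continuousAt_const) hd.ne').rpow_const
    (Or.inr hμ0.le)

lemma mul_volume_le_setIntegral {g : 𝔼 → ℝ} {s t : Set 𝔼} (hs : MeasurableSet s)
    (ht : MeasurableSet t) (hts : t ⊆ s) (htf : volume t ≠ ⊤) (hg : IntegrableOn g s)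
    (hg0 : ∀ᵐ z ∂volume, z ∈ s → 0 ≤ g z) {c : ℝ} (hc : ∀ᵐ z ∂volume, z ∈ t → c ≤ g z) :
    c * volume.real t ≤ ∫ z in s, g z := by
  calc c * volume.real t = ∫ z in t, c := by simp [mul_comm]
    _ ≤ ∫ z in t, g z :=
      setIntegral_mono_on_ae (integrableOn_const htf) (hg.mono_set hts) ht hc
    _ ≤ ∫ z in s, g z :=
      setIntegral_mono_set hg ((ae_restrict_iff' hs).2 hg0) (LE.le.eventuallyLE hts)

lemma weight_mul_exp_sub_one_nonneg (hμn : μ < n) {b : 𝔼} {r : ℝ} {z : 𝔼}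
    (h : 0 ≤ reflGap u b r z) :
    0 ≤ weight n μ u z * (Real.exp ((2 * n - μ) / 2 * reflGap u b r z) - 1) := by
  have hp : 0 < (2 * n - μ) / 2 := by linarith [(Nat.cast_nonneg n : (0 : ℝ) ≤ n)]
  exact mul_nonneg (weight_pos z).le (sub_nonneg.2 (Real.one_le_exp (by positivity)))

lemma mul_weight_mul_exp_sub_one_le_curvGap {b : 𝔼} {r : ℝ} {z : 𝔼}
    (h' : 0 ≤ kelvinGap n μ u b r z) :
    V n μ u z * (weight n μ u z * (Real.exp ((2 * n - μ) / 2 * reflGap u b r z) - 1)) ≤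
      curvGap n μ u b r z := by
  rw [curvGap, mul_left_comm]
  refine mul_le_mul_of_nonneg_left ?_ (weight_pos z).le
  nlinarith [Real.exp_pos ((2 * n - μ) / 2 * reflGap u b r z)]

lemma log_reflDist_div_nonneg {b : 𝔼} {r : ℝ} (hr : 0 < r) {y z : 𝔼} (hz : z ≠ b)
    (hyr : dist y b < r) (hzr : dist z b < r) (hzy : z ≠ y) :
    0 ≤ Real.log (reflDist b r y z / dist y z) := by
  refine Real.log_nonneg ?_
  rw [one_le_div (dist_pos.2 hzy.symm)]
  exact (dist_lt_reflDist hr hz hyr hzr).le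

lemma inv_rpow_sub_inv_rpow_nonneg (hμ0 : 0 < μ) {b : 𝔼} {r : ℝ} (hr : 0 < r) {y z : 𝔼}
    (hz : z ≠ b) (hyr : dist y b < r) (hzr : dist z b < r) (hzy : z ≠ y) :
    0 ≤ (dist y z ^ μ)⁻¹ - (reflDist b r y z ^ μ)⁻¹ := by
  have hd : 0 < dist y z := dist_pos.2 hzy.symm
  have := dist_lt_reflDist hr hz hyr hzr
  rw [sub_nonneg]
  gcongr

lemma GapsNonneg.exists_forall_le (hn : 1 ≤ n) (hμ0 : 0 < μ) (hμn : μ < n) (hu : Continuous u)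
    (hB : CondB n μ u) (hIE : IE n μ u) {b : 𝔼} {r : ℝ} (hr : 0 < r)
    (h : GapsNonneg n μ u b r) {y₀ : 𝔼} (hy₀ : y₀ ∈ ball b r \ {b})
    (hpos : 0 < reflGap u b r y₀) {s : ℝ} (hs0 : 0 ≤ s) (hs : s < r) :
    ∃ c, 0 < c ∧ ∀ y ∈ ball b r \ {b}, dist y b ≤ s →
      c ≤ reflGap u b r y ∧ c ≤ kelvinGap n μ u b r y := by
  have hα := alphaC_le_two hn hμ0 hμn hu hB hIE hr fun y hy => (h y hy).1
  have hβ := betaN_pos hn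
  have hp : 0 < (2 * n - μ) / 2 := by linarith [(Nat.cast_nonneg n : (0 : ℝ) ≤ n)]
  set p := (2 * n - μ) / 2 with hpdef
  set c₀ := reflGap u b r y₀ / 2 with hc₀
  have hc₀0 : 0 < c₀ := by positivity
  obtain ⟨ε, hε, hεQ⟩ : ∃ ε, 0 < ε ∧ ∀ z ∈ closedBall y₀ ε,
      z ≠ b ∧ c₀ < reflGap u b r z ∧ dist y₀ b + ε < r := by
    have h1 : ∀ᶠ z in 𝓝 y₀, c₀ < reflGap u b r z :=
      ((continuousAt_reflGap hu hr hy₀.2).comp (f := fun z : 𝔼 => (r, z))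
        (by fun_prop)).eventually (lt_mem_nhds (half_lt_self hpos))
    have h2 : ∀ᶠ z in 𝓝 y₀, z ≠ b := eventually_ne_nhds hy₀.2
    obtain ⟨ε, hε, hεs⟩ := nhds_basis_closedBall.eventually_iff.1 (h1.and h2)
    have h3 : 0 < r - dist y₀ b := sub_pos.2 hy₀.1
    refine ⟨min ε ((r - dist y₀ b) / 2), by positivity, fun z hz => ?_⟩
    have h4 := hεs (closedBall_subset_closedBall (min_le_left _ _) hz)
    refine ⟨h4.2, h4.1, ?_⟩
    linarith [min_le_right ε ((r - dist y₀ b) / 2)]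
  set t := dist y₀ b + ε with ht
  have htr : t < r := (hεQ y₀ (mem_closedBall_self hε.le)).2.2
  have ht0 : 0 ≤ t := by positivity
  have hQt : ∀ z ∈ closedBall y₀ ε, dist z b ≤ t := fun z hz => by
    linarith [dist_triangle z y₀ b, mem_closedBall.1 hz]
  have hQB : closedBall y₀ ε ⊆ ball b r \ {b} := fun z hz =>
    ⟨(hQt z hz).trans_lt htr, (hεQ z hz).1⟩
  have hne : (closedBall y₀ ε).Nonempty := ⟨y₀, mem_closedBall_self hε.le⟩
  obtain ⟨zw, -, hzw⟩ := (isCompact_closedBall y₀ ε).exists_isMinOn hne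
    (continuous_weight (μ := μ) hu).continuousOn
  obtain ⟨zv, -, hzv⟩ := (isCompact_closedBall y₀ ε).exists_isMinOn hne
    (continuous_V hn hμ0 hμn hu hB).continuousOn
  set w₀ := weight n μ u zw with hw₀
  set v₀ := V n μ u zv with hv₀
  have hw₀0 : 0 < w₀ := weight_pos _
  have hv₀0 : 0 < v₀ := V_pos hn hμ0 hμn hu hB _
  obtain ⟨θ, hθ0, hθ1, hθ⟩ := exists_dist_le_mul_reflDist (n := n) hs htr hs0 ht0
  set e := Real.exp (p * c₀) - 1 with he
  have he0 : 0 < e := sub_pos.2 (Real.one_lt_exp_iff.2 (by positivity))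
  have hwe : ∀ z ∈ closedBall y₀ ε,
      w₀ * e ≤ weight n μ u z * (Real.exp (p * reflGap u b r z) - 1) := by
    intro z hz
    exact mul_le_mul (isMinOn_iff.1 hzw z hz)
      (sub_le_sub_right (Real.exp_le_exp.2 (mul_le_mul_of_nonneg_left (hεQ z hz).2.1.le hp.le)) 1)
      he0.le (weight_pos z).le
  have hcurv : ∀ z ∈ closedBall y₀ ε, v₀ * (w₀ * e) ≤ curvGap n μ u b r z := by
    intro z hz
    refine le_trans ?_ (mul_weight_mul_exp_sub_one_le_curvGap (h z (hQB hz)).2)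
    exact mul_le_mul (isMinOn_iff.1 hzv z hz) (hwe z hz) (by positivity)
      (V_pos hn hμ0 hμn hu hB z).le
  have hvol : 0 < volume.real (closedBall y₀ ε) :=
    ENNReal.toReal_pos (measure_closedBall_pos volume _ hε).ne' measure_closedBall_lt_top.ne
  have hlθ : 0 < Real.log θ⁻¹ := Real.log_pos ((one_lt_inv₀ hθ0).2 hθ1)
  have hrθ : 0 < 1 - θ ^ μ := sub_pos.2 (Real.rpow_lt_one hθ0.le hθ1 hμ0)
  set c₁ := 1 / betaN n * (Real.log θ⁻¹ * (v₀ * (w₀ * e)) * volume.real (closedBall y₀ ε))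
    with hc₁
  set c₂ := ((2 * r) ^ μ)⁻¹ * (1 - θ ^ μ) * (w₀ * e) * volume.real (closedBall y₀ ε) with hc₂
  refine ⟨min c₁ c₂, by positivity, fun y hy hys => ⟨(min_le_left _ _).trans ?_,
    (min_le_right _ _).trans ?_⟩⟩
  · obtain ⟨h1, h2⟩ := reflGap_eq hn hμ0 hμn hu hB hIE hr hy
    have h3 : 0 ≤ (alphaC n μ u - 2) * Real.log (dist y b / r) := by
      refine mul_nonneg_of_nonpos_of_nonpos (by linarith) (Real.log_nonpos (by positivity) ?_)
      rw [div_le_one hr]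
      exact (mem_ball.1 hy.1).le
    have h4 := mul_volume_le_setIntegral (c := Real.log θ⁻¹ * (v₀ * (w₀ * e)))
      (measurableSet_punctured_ball b r) measurableSet_closedBall hQB
      measure_closedBall_lt_top.ne h1 ?_ ?_
    · rw [h2]
      have := mul_le_mul_of_nonneg_left h4 (one_div_pos.2 hβ).le
      linarith
    · filter_upwards [ae_ne_point hn y] with z hzy hz
      refine mul_nonneg (log_reflDist_div_nonneg hr hz.2 hy.1 hz.1 hzy) ?_
      refine le_trans ?_ (mul_weight_mul_exp_sub_one_le_curvGap (h z hz).2)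
      exact mul_nonneg (V_pos hn hμ0 hμn hu hB z).le
        (weight_mul_exp_sub_one_nonneg hμn (h z hz).1)
    · filter_upwards [ae_ne_point hn y] with z hzy hz
      have hd : 0 < dist y z := dist_pos.2 hzy.symm
      have hle := hθ b y z (hQB hz).2 hys (hQt z hz)
      refine mul_le_mul (Real.log_le_log (by positivity) ?_) (hcurv z hz) (by positivity)
        (log_reflDist_div_nonneg hr (hQB hz).2 hy.1 (hQB hz).1 hzy)
      rw [inv_eq_one_div, div_le_div_iff₀ hθ0 hd]
      linarith
  · obtain ⟨h1, h2⟩ := kelvinGap_eq hn hμ0 hμn hu hB hr hy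
    have h4 := mul_volume_le_setIntegral (c := ((2 * r) ^ μ)⁻¹ * (1 - θ ^ μ) * (w₀ * e))
      (measurableSet_punctured_ball b r) measurableSet_closedBall hQB
      measure_closedBall_lt_top.ne h1 ?_ ?_
    · rw [h2]
      exact h4
    · filter_upwards [ae_ne_point hn y] with z hzy hz
      exact mul_nonneg (inv_rpow_sub_inv_rpow_nonneg hμ0 hr hz.2 hy.1 hz.1 hzy)
        (weight_mul_exp_sub_one_nonneg hμn (h z hz).1)
    · filter_upwards [ae_ne_point hn y] with z hzy hz
      have hd : 0 < dist y z := dist_pos.2 hzy.symm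
      have hle := hθ b y z (hQB hz).2 hys (hQt z hz)
      have hlt := dist_lt_reflDist hr (hQB hz).2 hy.1 (hQB hz).1
      have hD : 0 < reflDist b r y z := hd.trans hlt
      have hd2 : dist y z ≤ 2 * r := hlt.le.trans (reflDist_le hr (hQB hz).2 hy.1 (hQB hz).1)
      refine mul_le_mul ?_ (hwe z hz) (by positivity)
        (inv_rpow_sub_inv_rpow_nonneg hμ0 hr (hQB hz).2 hy.1 (hQB hz).1 hzy)
      have h5 : (reflDist b r y z ^ μ)⁻¹ ≤ θ ^ μ * (dist y z ^ μ)⁻¹ := by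
        rw [← div_eq_mul_inv, inv_eq_one_div, div_le_div_iff₀ (by positivity) (by positivity),
          one_mul, ← Real.mul_rpow hθ0.le hD.le]
        gcongr
      have h6 : ((2 * r) ^ μ)⁻¹ ≤ (dist y z ^ μ)⁻¹ := by gcongr
      nlinarith

end StrictPositivity

section NarrowRegion

open Set EuclideanGeometry Topology

variable {n : ℕ} {μ : ℝ} {u : EuclideanSpace ℝ (Fin n) → ℝ}

local notation "𝔼" => EuclideanSpace ℝ (Fin n)

lemma exists_setIntegral_inv_norm_rpow_le (hn : 1 ≤ n) (hμn : μ < n) (R : ℝ) {ε : ℝ}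
    (hε : 0 < ε) : ∃ δ : ENNReal, 0 < δ ∧ ∀ s : Set 𝔼, MeasurableSet s → s ⊆ ball 0 R →
      volume s < δ → ∫ z in s, (‖z‖ ^ μ)⁻¹ ≤ ε := by
  have h := integrableOn_ball_inv_norm_rpow hn hμn R
  rw [← integrable_indicator_iff measurableSet_ball] at h
  have ht := h.tendsto_setIntegral_nhds_zero (μ := volume) (s := fun s : Set 𝔼 => s)
    (l := comap volume (𝓝 0)) tendsto_comap
  obtain ⟨δ, hδ, hs⟩ := (ENNReal.nhds_zero_basis.comap _).eventually_iff.1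
    (ht.eventually (gt_mem_nhds hε))
  refine ⟨δ, hδ, fun s hsm hsR hsδ => le_trans (le_of_eq ?_) (hs hsδ).le⟩
  exact setIntegral_congr_fun hsm fun z hz => (indicator_of_mem (hsR hz) fun y : 𝔼 => (‖y‖ ^ μ)⁻¹).symm

lemma volume_annulus_le (hn : 1 ≤ n) (b : 𝔼) {r R κ : ℝ} (hr : 0 ≤ r) (hrR : r ≤ R)
    (hκ0 : 0 ≤ κ) (hκ : κ < 1) : volume (ball b r \ closedBall b (κ * r)) ≤
      ENNReal.ofReal (R ^ n * (1 - κ ^ n)) * volume (ball (0 : 𝔼) 1) := by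
  rcases hr.eq_or_lt with rfl | hr0
  · simp
  have hnt : Nontrivial 𝔼 := Module.nontrivial_of_finrank_pos (R := ℝ) (by simp; lia)
  have hκr : κ * r < r := by nlinarith
  have hκn : κ ^ n ≤ 1 := pow_le_one₀ hκ0 hκ.le
  rw [measure_sdiff (closedBall_subset_ball hκr) measurableSet_closedBall.nullMeasurableSet
    measure_closedBall_lt_top.ne, Measure.addHaar_ball _ _ hr,
    Measure.addHaar_closedBall _ _ (by positivity), finrank_euclideanSpace_fin,
    ← ENNReal.sub_mul (fun _ _ => measure_ball_lt_top.ne),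
    ← ENNReal.ofReal_sub _ (by positivity)]
  gcongr
  calc r ^ n - (κ * r) ^ n = r ^ n * (1 - κ ^ n) := by rw [mul_pow]; ring
    _ ≤ R ^ n * (1 - κ ^ n) := by gcongr

lemma exists_setIntegral_annulus_le (hn : 1 ≤ n) (hμn : μ < n) (R : ℝ) {ε : ℝ} (hε : 0 < ε) :
    ∃ κ : ℝ, 1 / 2 ≤ κ ∧ κ < 1 ∧ ∀ (b : 𝔼) (r : ℝ), 0 ≤ r → r ≤ R → ∀ y ∈ ball b r,
      IntegrableOn (fun z => (dist y z ^ μ)⁻¹) (ball b r \ closedBall b (κ * r)) ∧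
        ∫ z in ball b r \ closedBall b (κ * r), (dist y z ^ μ)⁻¹ ≤ ε := by
  obtain ⟨δ, hδ, hs⟩ := exists_setIntegral_inv_norm_rpow_le (n := n) hn hμn (2 * R) hε
  have hc : Tendsto (fun κ : ℝ => ENNReal.ofReal (R ^ n * (1 - κ ^ n)) * volume (ball (0 : 𝔼) 1))
      (𝓝 1) (𝓝 0) := by
    have h1 : Tendsto (fun κ : ℝ => ENNReal.ofReal (R ^ n * (1 - κ ^ n))) (𝓝 1) (𝓝 0) := by
      have : Continuous fun κ : ℝ => ENNReal.ofReal (R ^ n * (1 - κ ^ n)) :=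
        ENNReal.continuous_ofReal.comp (by fun_prop)
      simpa using this.tendsto 1
    simpa using ENNReal.Tendsto.mul_const h1 (Or.inr measure_ball_lt_top.ne)
  obtain ⟨κ, hκδ, hκ, hκ1⟩ := (((hc.eventually (gt_mem_nhds hδ)).filter_mono
    nhdsWithin_le_nhds).and (Ico_mem_nhdsLT (by norm_num : (1 / 2 : ℝ) < 1))).exists
  refine ⟨κ, hκ, hκ1, fun b r hr hrR y hy => ?_⟩
  set A := ball b r \ closedBall b (κ * r) with hA
  have hAm : MeasurableSet A := measurableSet_ball.diff measurableSet_closedBall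
  have hmp := measurePreserving_add_right (volume : Measure 𝔼) y
  have hme := measurableEmbedding_addRight y
  have hsub : (· + y) ⁻¹' A ⊆ ball (0 : 𝔼) (2 * R) := by
    intro z hz
    have h1 : dist (z + y) b < r := hz.1
    have h2 : dist y b < r := hy
    have h3 := dist_triangle_right (z + y) y b
    rw [dist_eq_norm, add_sub_cancel_right] at h3
    rw [mem_ball_zero_iff]
    linarith
  have hfun : (fun z => (dist y z ^ μ)⁻¹) ∘ (· + y) = fun z : 𝔼 => (‖z‖ ^ μ)⁻¹ := by
    ext z
    simp
  constructor
  · rw [← hmp.integrableOn_comp_preimage hme, hfun]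
    exact (integrableOn_ball_inv_norm_rpow hn hμn (2 * R)).mono_set hsub
  · rw [← hmp.setIntegral_preimage_emb hme]
    refine le_trans (le_of_eq ?_) (hs _ (hAm.preimage hme.measurable) hsub ?_)
    · simp
    · rw [hmp.measure_preimage_emb hme]
      exact (volume_annulus_le hn b hr hrR (by linarith) hκ1).trans_lt hκδ

lemma neg_mul_le_setIntegral {g k : 𝔼 → ℝ} {s t : Set 𝔼} (hs : MeasurableSet s)
    (ht : MeasurableSet t) (hts : t ⊆ s) (hg : IntegrableOn g s) (hk : IntegrableOn k t)
    {M ε : ℝ} (hM : 0 ≤ M) (hkε : ∫ z in t, k z ≤ ε)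
    (h0 : ∀ᵐ z, z ∈ s → z ∉ t → 0 ≤ g z) (h1 : ∀ᵐ z, z ∈ t → -(M * k z) ≤ g z) :
    -(M * ε) ≤ ∫ z in s, g z := by
  have hk' : IntegrableOn (fun z => -(M * k z)) t := (hk.const_mul M).neg
  calc -(M * ε) ≤ -(M * ∫ z in t, k z) := by gcongr
    _ = ∫ z in t, -(M * k z) := by rw [integral_neg, integral_const_mul]
    _ = ∫ z in s, t.indicator (fun z => -(M * k z)) z := by
      rw [setIntegral_indicator ht, inter_eq_self_of_subset_right hts]
    _ ≤ ∫ z in s, g z := by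
      refine setIntegral_mono_on_ae ((integrable_indicator_iff ht).2 hk').integrableOn hg hs ?_
      filter_upwards [h0, h1] with z h0 h1 hz
      by_cases hzt : z ∈ t
      · rw [indicator_of_mem hzt]
        exact h1 hzt
      · rw [indicator_of_notMem hzt]
        exact h0 hz hzt

lemma log_reflDist_div_le (hμ0 : 0 < μ) {b : 𝔼} {r R : ℝ} (hr : 0 < r) (hrR : r ≤ R) {y z : 𝔼}
    (hz : z ≠ b) (hyr : dist y b < r) (hzr : dist z b < r) (hzy : z ≠ y) :
    Real.log (reflDist b r y z / dist y z) ≤ (2 * R) ^ μ / μ * (dist y z ^ μ)⁻¹ := by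
  have hd : 0 < dist y z := dist_pos.2 hzy.symm
  have hD := reflDist_nonneg b hr y z
  have hD2 : reflDist b r y z ≤ 2 * R := by
    linarith [reflDist_le hr hz hyr hzr]
  calc Real.log (reflDist b r y z / dist y z) ≤ (reflDist b r y z / dist y z) ^ μ / μ :=
        Real.log_le_rpow_div (by positivity) hμ0
    _ ≤ ((2 * R) / dist y z) ^ μ / μ := by gcongr
    _ = (2 * R) ^ μ / μ * (dist y z ^ μ)⁻¹ := by
      rw [Real.div_rpow (by linarith) hd.le]
      ring

lemma neg_le_weight_mul_exp_sub_one (hμn : μ < n) {b : 𝔼} {r M S : ℝ} {z : 𝔼} (hS : 0 ≤ S)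
    (hM : weight n μ u z ≤ M) (hW : -S ≤ reflGap u b r z) :
    -(M * ((2 * n - μ) / 2) * S) ≤
      weight n μ u z * (Real.exp ((2 * n - μ) / 2 * reflGap u b r z) - 1) := by
  have hp : 0 < (2 * n - μ) / 2 := by linarith [(Nat.cast_nonneg n : (0 : ℝ) ≤ n)]
  set p := (2 * n - μ) / 2
  have hw := weight_pos (μ := μ) (u := u) z
  have h1 := Real.add_one_le_exp (p * reflGap u b r z)
  have h2 : -(p * S) ≤ p * reflGap u b r z := by nlinarith
  have h3 : weight n μ u z * (p * S) ≤ M * (p * S) := by gcongr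
  nlinarith

lemma neg_le_curvGap (hμn : μ < n) {b : 𝔼} {r M N S : ℝ} {z : 𝔼} (hS : 0 ≤ S)
    (hM : weight n μ u z ≤ M) (hN0 : 0 ≤ V n μ u z + kelvinGap n μ u b r z)
    (hN : V n μ u z + kelvinGap n μ u b r z ≤ N) (hW : -S ≤ reflGap u b r z)
    (hZ : -S ≤ kelvinGap n μ u b r z) :
    -(M * (1 + N * ((2 * n - μ) / 2)) * S) ≤ curvGap n μ u b r z := by
  have hp : 0 < (2 * n - μ) / 2 := by linarith [(Nat.cast_nonneg n : (0 : ℝ) ≤ n)]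
  rw [curvGap]
  set p := (2 * n - μ) / 2
  set q := V n μ u z + kelvinGap n μ u b r z with hq
  have hw := weight_pos (μ := μ) (u := u) z
  have h1 := Real.add_one_le_exp (p * reflGap u b r z)
  have h2 : -(p * S) ≤ p * reflGap u b r z := by nlinarith
  have h3 : q * (1 - p * S) ≤ q * Real.exp (p * reflGap u b r z) := by
    gcongr
    linarith
  have h4 : q * (p * S) ≤ N * (p * S) := by gcongr
  have h5 : -((1 + N * p) * S) ≤ q * Real.exp (p * reflGap u b r z) - V n μ u z := by
    linarith
  have hN' := hN0.trans hN
  have h6 : weight n μ u z * ((1 + N * p) * S) ≤ M * ((1 + N * p) * S) := by gcongr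
  nlinarith

lemma gapsNonneg_of_narrow (hn : 1 ≤ n) (hμ0 : 0 < μ) (hμn : μ < n) (hu : Continuous u)
    (hB : CondB n μ u) (hIE : IE n μ u) (hα : alphaC n μ u ≤ 2) (b : 𝔼) {R : ℝ} (hR : 0 < R) :
    ∃ κ : ℝ, 1 / 2 ≤ κ ∧ κ < 1 ∧ ∀ r, 0 < r → r ≤ R →
      (∀ y ∈ ball b r \ {b}, dist y b ≤ κ * r →
        0 ≤ reflGap u b r y ∧ 0 ≤ kelvinGap n μ u b r y) → GapsNonneg n μ u b r := by
  have hβ := betaN_pos hn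
  have hp : 0 < (2 * n - μ) / 2 := by linarith [(Nat.cast_nonneg n : (0 : ℝ) ≤ n)]
  set p := (2 * n - μ) / 2 with hpdef
  have hVc := continuous_V hn hμ0 hμn hu hB
  obtain ⟨M, hM⟩ := (isCompact_closedBall b R).bddAbove_image
    (continuous_weight (μ := μ) hu).continuousOn
  obtain ⟨Mv, hMv⟩ := (isCompact_closedBall b (2 * R)).bddAbove_image hVc.continuousOn
  have hM' : ∀ z, dist z b ≤ R → weight n μ u z ≤ M := fun z hz => hM ⟨z, hz, rfl⟩
  have hMv' : ∀ z, dist z b ≤ 2 * R → V n μ u z ≤ Mv := fun z hz => hMv ⟨z, hz, rfl⟩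
  have hM0 : 0 < M := (weight_pos b).trans_le (hM' b (by simpa using hR.le))
  have hMv0 : 0 < Mv :=
    (V_pos hn hμ0 hμn hu hB b).trans_le (hMv' b (by simpa using hR.le))
  set N := (2 : ℝ) ^ μ * Mv with hN
  set K₁ := (2 * R) ^ μ / μ * (M * (1 + N * p)) with hK₁
  set K₂ := M * p with hK₂
  have hK₁0 : 0 < K₁ := by positivity
  have hK₂0 : 0 < K₂ := by positivity
  set K := 1 / betaN n * K₁ + K₂ with hK
  have hK0 : 0 < K := by positivity
  obtain ⟨κ, hκ, hκ1, hint⟩ := exists_setIntegral_annulus_le (n := n) hn hμn R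
    (ε := 1 / (2 * K)) (by positivity)
  refine ⟨κ, hκ, hκ1, fun r hr hrR hcore => ?_⟩
  set A := ball b r \ closedBall b (κ * r) with hA
  have hAm : MeasurableSet A := measurableSet_ball.diff measurableSet_closedBall
  have hAb : ∀ z ∈ A, z ≠ b := by
    rintro z hz rfl
    exact hz.2 (mem_closedBall_self (by positivity))
  have hAB : A ⊆ ball b r \ {b} := fun z hz => ⟨hz.1, hAb z hz⟩
  have hcore' : ∀ z ∈ ball b r \ {b}, z ∉ A →
      0 ≤ reflGap u b r z ∧ 0 ≤ kelvinGap n μ u b r z := by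
    intro z hz hzA
    refine hcore z hz ?_
    by_contra h
    exact hzA ⟨hz.1, h⟩
  have hq : ∀ z ∈ A, 0 ≤ V n μ u z + kelvinGap n μ u b r z ∧
      V n μ u z + kelvinGap n μ u b r z ≤ N := by
    intro z hz
    have hd : 0 < dist z b := dist_pos.2 (hAb z hz)
    have hκd : r / 2 ≤ dist z b := by
      have : κ * r < dist z b := not_le.1 hz.2
      nlinarith
    have hVi := V_pos hn hμ0 hμn hu hB (inversion b r z)
    rw [kelvinGap, add_sub_cancel]
    refine ⟨by positivity, ?_⟩
    have h2 : r / dist z b ≤ 2 := by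
      rw [div_le_iff₀ hd]
      linarith
    have h3 : V n μ u (inversion b r z) ≤ Mv := by
      apply hMv'
      rw [dist_inversion_center, div_le_iff₀ hd]
      nlinarith
    rw [hN]
    gcongr
  have step : ∀ S, 0 ≤ S → (∀ z ∈ A, -S ≤ reflGap u b r z ∧ -S ≤ kelvinGap n μ u b r z) →
      ∀ z ∈ A, -(S / 2) ≤ reflGap u b r z ∧ -(S / 2) ≤ kelvinGap n μ u b r z := by
    intro S hS hSA y hyA
    have hy := hAB hyA
    obtain ⟨hki, hkε⟩ := hint b r hr.le hrR y hy.1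
    have hSK : S * K * (1 / (2 * K)) = S / 2 := by field_simp
    constructor
    · obtain ⟨h1, h2⟩ := reflGap_eq hn hμ0 hμn hu hB hIE hr hy
      have h3 : 0 ≤ (alphaC n μ u - 2) * Real.log (dist y b / r) := by
        refine mul_nonneg_of_nonpos_of_nonpos (by linarith) (Real.log_nonpos (by positivity) ?_)
        rw [div_le_one hr]
        exact (mem_ball.1 hy.1).le
      have h4 := neg_mul_le_setIntegral (M := K₁ * S) (measurableSet_punctured_ball b r) hAm hAB
        h1 hki (by positivity) hkε ?_ ?_
      · rw [h2]
        have h5 := mul_le_mul_of_nonneg_left h4 (one_div_pos.2 hβ).le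
        have h6 : 0 ≤ K₂ * S * (1 / (2 * K)) := by positivity
        have h7 : 1 / betaN n * (K₁ * S * (1 / (2 * K))) + K₂ * S * (1 / (2 * K)) = S / 2 := by
          rw [← hSK, hK]
          ring
        linarith
      · filter_upwards [ae_ne_point hn y] with z hzy hz hzA
        obtain ⟨hW, hZ⟩ := hcore' z hz hzA
        refine mul_nonneg (log_reflDist_div_nonneg hr hz.2 hy.1 hz.1 hzy) ?_
        refine le_trans ?_ (mul_weight_mul_exp_sub_one_le_curvGap hZ)
        exact mul_nonneg (V_pos hn hμ0 hμn hu hB z).le (weight_mul_exp_sub_one_nonneg hμn hW)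
      · filter_upwards [ae_ne_point hn y] with z hzy hz
        have hzB := hAB hz
        have hzr : dist z b < r := hz.1
        have hL0 := log_reflDist_div_nonneg hr hzB.2 hy.1 hzB.1 hzy
        have hL := log_reflDist_div_le hμ0 hr hrR hzB.2 hy.1 hzB.1 hzy
        have hC : -(M * (1 + N * p) * S) ≤ curvGap n μ u b r z :=
          neg_le_curvGap hμn hS (hM' z (hzr.le.trans hrR)) (hq z hz).1 (hq z hz).2
          (hSA z hz).1 (hSA z hz).2
        have hC0 : 0 ≤ M * (1 + N * p) * S := by positivity
        have h5 := mul_le_mul_of_nonneg_left hC hL0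
        have h6 := mul_le_mul_of_nonneg_right hL hC0
        refine le_trans (le_of_eq_of_le ?_ (neg_le_neg h6)) (by linarith)
        rw [hK₁]
        ring
    · obtain ⟨h1, h2⟩ := kelvinGap_eq hn hμ0 hμn hu hB hr hy
      have h4 := neg_mul_le_setIntegral (M := K₂ * S) (measurableSet_punctured_ball b r) hAm hAB
        h1 hki (by positivity) hkε ?_ ?_
      · rw [h2]
        have h6 : 0 ≤ 1 / betaN n * (K₁ * S * (1 / (2 * K))) := by positivity
        have h7 : 1 / betaN n * (K₁ * S * (1 / (2 * K))) + K₂ * S * (1 / (2 * K)) = S / 2 := by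
          rw [← hSK, hK]
          ring
        linarith
      · filter_upwards [ae_ne_point hn y] with z hzy hz hzA
        exact mul_nonneg (inv_rpow_sub_inv_rpow_nonneg hμ0 hr hz.2 hy.1 hz.1 hzy)
          (weight_mul_exp_sub_one_nonneg hμn (hcore' z hz hzA).1)
      · filter_upwards [ae_ne_point hn y] with z hzy hz
        have hzB := hAB hz
        have hzr : dist z b < r := hz.1
        have hL0 := inv_rpow_sub_inv_rpow_nonneg hμ0 hr hzB.2 hy.1 hzB.1 hzy
        have hL : (dist y z ^ μ)⁻¹ - (reflDist b r y z ^ μ)⁻¹ ≤ (dist y z ^ μ)⁻¹ := by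
          have := reflDist_nonneg b hr y z
          exact sub_le_self _ (by positivity)
        have hC : -(M * p * S) ≤ weight n μ u z * (Real.exp (p * reflGap u b r z) - 1) :=
          neg_le_weight_mul_exp_sub_one hμn hS (hM' z (hzr.le.trans hrR)) (hSA z hz).1
        have hC0 : 0 ≤ M * p * S := by positivity
        have h5 := mul_le_mul_of_nonneg_left hC hL0
        have h6 := mul_le_mul_of_nonneg_right hL hC0
        linarith
  obtain ⟨S, hS0, hS⟩ : ∃ S, 0 ≤ S ∧
      ∀ z ∈ A, -S ≤ reflGap u b r z ∧ -S ≤ kelvinGap n μ u b r z := by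
    have hcomp : IsCompact (closedBall b r \ ball b (κ * r)) :=
      (isCompact_closedBall b r).diff isOpen_ball
    have hne : ∀ z ∈ closedBall b r \ ball b (κ * r), z ≠ b := by
      rintro z hz rfl
      exact hz.2 (mem_ball_self (by nlinarith))
    have hsub : A ⊆ closedBall b r \ ball b (κ * r) :=
      sdiff_subset_sdiff ball_subset_closedBall ball_subset_closedBall
    have hcr : ∀ z : 𝔼, ContinuousAt (fun z : 𝔼 => (r, z)) z := fun z => by fun_prop
    obtain ⟨S₁, hS₁⟩ := hcomp.bddBelow_image (f := reflGap u b r) fun z hz =>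
      ((continuousAt_reflGap hu hr (hne z hz)).comp (hcr z)).continuousWithinAt
    obtain ⟨S₂, hS₂⟩ := hcomp.bddBelow_image (f := kelvinGap n μ u b r) fun z hz =>
      ((continuousAt_kelvinGap hn hμ0 hμn hu hB (hne z hz)).comp (hcr z)).continuousWithinAt
    refine ⟨|S₁| + |S₂|, by positivity, fun z hz => ⟨?_, ?_⟩⟩
    · have : S₁ ≤ reflGap u b r z := hS₁ ⟨z, hsub hz, rfl⟩
      linarith [neg_abs_le S₁, abs_nonneg S₂]
    · have : S₂ ≤ kelvinGap n μ u b r z := hS₂ ⟨z, hsub hz, rfl⟩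
      linarith [neg_abs_le S₂, abs_nonneg S₁]
  have hall : ∀ k : ℕ, ∀ z ∈ A, -(S * (1 / 2) ^ k) ≤ reflGap u b r z ∧
      -(S * (1 / 2) ^ k) ≤ kelvinGap n μ u b r z := by
    intro k
    induction k with
    | zero => simpa using hS
    | succ k ih =>
      have := step _ (by positivity) ih
      intro z hz
      have h := this z hz
      rw [pow_succ]
      constructor <;> linarith [h.1, h.2]
  have hlim : Tendsto (fun k : ℕ => -(S * (1 / 2 : ℝ) ^ k)) atTop (𝓝 0) := by
    simpa using ((tendsto_pow_atTop_nhds_zero_of_lt_one (by norm_num : (0 : ℝ) ≤ 1 / 2)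
      (by norm_num)).const_mul S).neg
  intro y hy
  by_cases hyA : y ∈ A
  · exact ⟨le_of_tendsto' hlim fun k => (hall k y hyA).1,
      le_of_tendsto' hlim fun k => (hall k y hyA).2⟩
  · exact hcore' y hy hyA

end NarrowRegion

section MovingSpheres

open Set EuclideanGeometry Topology

variable {n : ℕ} {μ : ℝ} {u : EuclideanSpace ℝ (Fin n) → ℝ}

local notation "𝔼" => EuclideanSpace ℝ (Fin n)

lemma dist_add_smul_sub_center {b y : 𝔼} {t : ℝ} (ht : 0 ≤ t) :
    dist (b + t • (y - b)) b = t * dist y b := by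
  rw [dist_eq_norm, add_sub_cancel_left, norm_smul, Real.norm_of_nonneg ht, dist_eq_norm]

lemma inversion_homothety {b y : 𝔼} {r s : ℝ} (hr : 0 < r) (hs : 0 < s) (hy : y ≠ b) :
    inversion b s (b + (s / r) ^ 2 • (y - b)) = inversion b r y := by
  have hd : 0 < dist y b := dist_pos.2 hy
  rw [inversion, inversion, dist_add_smul_sub_center (by positivity), vsub_eq_sub,
    add_sub_cancel_left, smul_smul, vsub_eq_sub]
  congr 2
  field_simp

lemma reflGap_homothety {b y : 𝔼} {r s : ℝ} (hr : 0 < r) (hs : 0 < s) (hy : y ≠ b) :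
    reflGap u b r y = reflGap u b s (b + (s / r) ^ 2 • (y - b)) +
      (u (b + (s / r) ^ 2 • (y - b)) - u y + 2 * Real.log (s / r)) := by
  have hd : 0 < dist y b := dist_pos.2 hy
  rw [reflGap, reflGap, inversion_homothety hr hs hy, dist_add_smul_sub_center (by positivity)]
  have : Real.log ((s / r) ^ 2 * dist y b / s) = Real.log (dist y b / r) + Real.log (s / r) := by
    rw [← Real.log_mul (by positivity) (by positivity)]
    congr 1
    field_simp
  rw [this]
  ring

lemma kelvinGap_homothety {b y : 𝔼} {r s : ℝ} (hr : 0 < r) (hs : 0 < s) (hy : y ≠ b) :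
    kelvinGap n μ u b r y = (s / r) ^ μ * (kelvinGap n μ u b s (b + (s / r) ^ 2 • (y - b)) +
      V n μ u (b + (s / r) ^ 2 • (y - b))) - V n μ u y := by
  have hd : 0 < dist y b := dist_pos.2 hy
  rw [kelvinGap, kelvinGap, inversion_homothety hr hs hy, dist_add_smul_sub_center (by positivity),
    sub_add_cancel, ← mul_assoc, ← Real.mul_rpow (by positivity) (by positivity)]
  congr 3
  field_simp

lemma GapsNonneg.exists_forall_Icc (hn : 1 ≤ n) (hμ0 : 0 < μ) (hμn : μ < n) (hu : Continuous u)
    (hB : CondB n μ u) (hIE : IE n μ u) {b : 𝔼} {s : ℝ} (hs : 0 < s)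
    (h : GapsNonneg n μ u b s) {y₀ : 𝔼} (hy₀ : y₀ ∈ ball b s \ {b})
    (hpos : 0 < reflGap u b s y₀) :
    ∃ s', s < s' ∧ ∀ r ∈ Icc s s', GapsNonneg n μ u b r := by
  have hα := alphaC_le_two hn hμ0 hμn hu hB hIE hs fun y hy => (h y hy).1
  have hVc := continuous_V hn hμ0 hμn hu hB
  obtain ⟨κ, hκ, hκ1, hnar⟩ := gapsNonneg_of_narrow hn hμ0 hμn hu hB hIE hα b
    (R := 2 * s) (by positivity)
  have hκs : κ * s < s := by nlinarith
  obtain ⟨c, hc, hcle⟩ := h.exists_forall_le hn hμ0 hμn hu hB hIE hs hy₀ hpos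
    (s := κ * s) (by positivity) hκs
  have hev : ∀ᶠ r in 𝓝 s, ∀ y ∈ closedBall b (2 * s),
      -c < u (b + (s / r) ^ 2 • (y - b)) - u y + 2 * Real.log (s / r) ∧
        0 < (s / r) ^ μ * (c + V n μ u (b + (s / r) ^ 2 • (y - b))) - V n μ u y := by
    refine (isCompact_closedBall b (2 * s)).eventually_forall_of_forall_eventually fun y _ => ?_
    have hdiv : ContinuousAt (fun q : ℝ × 𝔼 => s / q.1) (s, y) :=
      continuousAt_const.div continuousAt_fst hs.ne'
    have hhom : ContinuousAt (fun q : ℝ × 𝔼 => b + (s / q.1) ^ 2 • (q.2 - b)) (s, y) :=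
      continuousAt_const.add ((hdiv.pow 2).smul (continuousAt_snd.sub continuousAt_const))
    have hF : ContinuousAt (fun q : ℝ × 𝔼 =>
        u (b + (s / q.1) ^ 2 • (q.2 - b)) - u q.2 + 2 * Real.log (s / q.1)) (s, y) :=
      ((hu.continuousAt.comp hhom).sub (hu.continuousAt.comp continuousAt_snd)).add
        (continuousAt_const.mul (hdiv.log (by simp [hs.ne'])))
    have hG : ContinuousAt (fun q : ℝ × 𝔼 =>
        (s / q.1) ^ μ * (c + V n μ u (b + (s / q.1) ^ 2 • (q.2 - b))) - V n μ u q.2) (s, y) :=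
      ((hdiv.rpow_const (Or.inr hμ0.le)).mul
        (continuousAt_const.add (hVc.continuousAt.comp hhom))).sub
          (hVc.continuousAt.comp continuousAt_snd)
    refine (hF.eventually (lt_mem_nhds ?_)).and (hG.eventually (lt_mem_nhds ?_))
    · simpa [hs.ne'] using hc
    · simpa [hs.ne'] using hc
  obtain ⟨s', hs', hsub⟩ := (nhdsGE_basis_Icc (a := s)).eventually_iff.1
    ((hev.and (gt_mem_nhds (by linarith : s < 2 * s))).filter_mono nhdsWithin_le_nhds)
  refine ⟨s', hs', fun r hr => ?_⟩
  obtain ⟨hev, hr2⟩ := hsub hr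
  have hsr : s ≤ r := hr.1
  have hr0 : 0 < r := hs.trans_le hsr
  refine hnar r hr0 hr2.le fun y hy hyκ => ?_
  have hd : 0 < dist y b := dist_pos.2 hy.2
  obtain ⟨hF, hG⟩ := hev y (by
    have : dist y b < r := hy.1
    exact mem_closedBall.2 (by linarith))
  set y' := b + (s / r) ^ 2 • (y - b) with hy'
  have hdy' : dist y' b = (s / r) ^ 2 * dist y b := dist_add_smul_sub_center (by positivity)
  have hy'κ : dist y' b ≤ κ * s := by
    have h1 : s / r ≤ 1 := (div_le_one hr0).2 hsr
    calc dist y' b = (s / r) ^ 2 * dist y b := hdy'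
      _ ≤ (s / r) ^ 2 * (κ * r) := by gcongr
      _ = (s / r) * (κ * s) := by field_simp
      _ ≤ 1 * (κ * s) := by gcongr
      _ = κ * s := one_mul _
  have hy'B : y' ∈ ball b s \ {b} := by
    refine ⟨hy'κ.trans_lt hκs, dist_pos.1 ?_⟩
    rw [hdy']
    positivity
  obtain ⟨h1, h2⟩ := hcle y' hy'B hy'κ
  constructor
  · rw [reflGap_homothety hr0 hs hy.2]
    linarith
  · rw [kelvinGap_homothety hr0 hs hy.2]
    have : (s / r) ^ μ * (c + V n μ u y') ≤ (s / r) ^ μ * (kelvinGap n μ u b s y' + V n μ u y') := by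
      gcongr
    linarith

lemma inversion_add_smul {b x : 𝔼} {l : ℝ} (hl : 0 < l) (hx : 0 < ‖x‖) :
    inversion b l⁻¹ (b + (l ^ 2)⁻¹ • x) = b + (‖x‖ ^ 2)⁻¹ • x := by
  rw [inversion, dist_self_add_left, norm_smul, norm_inv, norm_pow, Real.norm_of_nonneg hl.le,
    vsub_eq_sub, add_sub_cancel_left, smul_smul, vadd_eq_add, add_comm]
  congr 2
  field_simp

lemma wMS_eq_reflGap {b x : 𝔼} {l : ℝ} (hl : 0 < l) (hx : 0 < ‖x‖) :
    wMS n u b l x = reflGap u b l⁻¹ (b + (l ^ 2)⁻¹ • x) := by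
  rw [wMS, reflGap, inversion_add_smul hl hx, dist_self_add_left, norm_smul, norm_inv, norm_pow,
    Real.norm_of_nonneg hl.le]
  have : (l ^ 2)⁻¹ * ‖x‖ / l⁻¹ = ‖x‖ / l := by field_simp
  rw [this, Real.log_div hx.ne' hl.ne']
  ring

lemma zMS_eq_kelvinGap {b x : 𝔼} {l : ℝ} (hl : 0 < l) (hx : 0 < ‖x‖) :
    zMS n μ u b l x = l ^ (-μ) * kelvinGap n μ u b l⁻¹ (b + (l ^ 2)⁻¹ • x) := by
  rw [zMS, kelvinGap, inversion_add_smul hl hx, dist_self_add_left, norm_smul, norm_inv, norm_pow,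
    Real.norm_of_nonneg hl.le]
  have : l⁻¹ / ((l ^ 2)⁻¹ * ‖x‖) = l / ‖x‖ := by field_simp
  rw [this, Real.div_rpow hl.le hx.le, Real.rpow_neg hl.le, Real.rpow_neg hx.le]
  have : 0 < l ^ μ := Real.rpow_pos_of_pos hl μ
  field_simp

lemma add_smul_mem_punctured_ball {b x : 𝔼} {l : ℝ} (hl : 0 < l) (hx : 0 < ‖x‖) (hxl : ‖x‖ < l) :
    b + (l ^ 2)⁻¹ • x ∈ ball b l⁻¹ \ {b} := by
  have hd : dist (b + (l ^ 2)⁻¹ • x) b = (l ^ 2)⁻¹ * ‖x‖ := by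
    rw [dist_self_add_left, norm_smul, norm_inv, norm_pow, Real.norm_of_nonneg hl.le]
  refine ⟨?_, dist_pos.1 (by rw [hd]; positivity)⟩
  rw [mem_ball, hd]
  calc (l ^ 2)⁻¹ * ‖x‖ < (l ^ 2)⁻¹ * l := by gcongr
    _ = l⁻¹ := by field_simp

lemma gapsNonneg_inv_iff {b : 𝔼} {l : ℝ} (hl : 0 < l) :
    GapsNonneg n μ u b l⁻¹ ↔ ∀ x : 𝔼, 0 < ‖x‖ → ‖x‖ < l →
      0 ≤ wMS n u b l x ∧ 0 ≤ zMS n μ u b l x := by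
  have hlμ : 0 < l ^ (-μ) := Real.rpow_pos_of_pos hl _
  constructor
  · intro h x hx hxl
    rw [wMS_eq_reflGap hl hx, zMS_eq_kelvinGap hl hx]
    obtain ⟨h1, h2⟩ := h _ (add_smul_mem_punctured_ball hl hx hxl)
    exact ⟨h1, by positivity⟩
  · intro h y hy
    have hd : 0 < dist y b := dist_pos.2 hy.2
    have hyl : dist y b < l⁻¹ := hy.1
    have hnorm : ‖l ^ 2 • (y - b)‖ = l ^ 2 * dist y b := by
      rw [norm_smul, norm_pow, Real.norm_of_nonneg hl.le, dist_eq_norm]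
    have hx : 0 < ‖l ^ 2 • (y - b)‖ := by
      rw [hnorm]
      positivity
    have hxl : ‖l ^ 2 • (y - b)‖ < l := by
      calc ‖l ^ 2 • (y - b)‖ = l ^ 2 * dist y b := hnorm
        _ < l ^ 2 * l⁻¹ := by gcongr
        _ = l := by field_simp
    have h1 := h _ hx hxl
    rw [wMS_eq_reflGap hl hx, zMS_eq_kelvinGap hl hx, inv_smul_smul₀ (by positivity),
      add_sub_cancel] at h1
    exact ⟨h1.1, nonneg_of_mul_nonneg_right h1.2 hlμ⟩

lemma gapsNonneg_of_forall_lt (hn : 1 ≤ n) (hμ0 : 0 < μ) (hμn : μ < n) (hu : Continuous u)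
    (hB : CondB n μ u) {b : 𝔼} {s : ℝ} (hs : 0 < s)
    (h : ∀ r, 0 < r → r < s → GapsNonneg n μ u b r) : GapsNonneg n μ u b s := by
  intro y hy
  have hys : dist y b < s := hy.1
  have hcr : Tendsto (fun r : ℝ => (r, y)) (𝓝[<] s) (𝓝 (s, y)) :=
    (ContinuousAt.tendsto (f := fun r : ℝ => (r, y)) (by fun_prop)).mono_left nhdsWithin_le_nhds
  have hev : ∀ᶠ r in 𝓝[<] s, 0 ≤ reflGap u b r y ∧ 0 ≤ kelvinGap n μ u b r y := by
    filter_upwards [Ioo_mem_nhdsLT hys] with r hr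
    exact h r (dist_nonneg.trans_lt hr.1) hr.2 y ⟨hr.1, hy.2⟩
  exact ⟨ge_of_tendsto ((continuousAt_reflGap hu hs hy.2).tendsto.comp hcr)
      (hev.mono fun _ h => h.1),
    ge_of_tendsto ((continuousAt_kelvinGap hn hμ0 hμn hu hB hy.2).tendsto.comp hcr)
      (hev.mono fun _ h => h.2)⟩

lemma kelvinGap_eq_zero (hn : 1 ≤ n) (hμ0 : 0 < μ) (hμn : μ < n) (hu : Continuous u)
    (hB : CondB n μ u) {b : 𝔼} {r : ℝ} (hr : 0 < r)
    (h : ∀ y ∈ ball b r \ {b}, reflGap u b r y = 0) {y : 𝔼} (hy : y ∈ ball b r \ {b}) :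
    kelvinGap n μ u b r y = 0 := by
  rw [(kelvinGap_eq hn hμ0 hμn hu hB hr hy).2]
  refine setIntegral_eq_zero_of_forall_eq_zero fun z hz => ?_
  simp [h z hz]

end MovingSpheres

theorem vanishing_at_critical_lambda (n : ℕ) (hn : 2 ≤ n) (μ : ℝ) (hμ0 : 0 < μ) (hμn : μ < n)
    (u : EuclideanSpace ℝ (Fin n) → ℝ) (hu : ContDiff ℝ n u)
    (hB : CondB n μ u) (hIE : IE n μ u)
    (b : EuclideanSpace ℝ (Fin n)) (hb : 0 < lambdaB n μ u b) :
    ∀ x : EuclideanSpace ℝ (Fin n), 0 < ‖x‖ → ‖x‖ < lambdaB n μ u b →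
      wMS n u b (lambdaB n μ u b) x = 0 ∧ zMS n μ u b (lambdaB n μ u b) x = 0 := by
  have hn1 : 1 ≤ n := by lia
  have huc := hu.continuous
  set T := {l : ℝ | 0 < l ∧ ∀ ρ : ℝ, l ≤ ρ → ∀ x : EuclideanSpace ℝ (Fin n),
    0 < ‖x‖ → ‖x‖ < ρ → 0 ≤ wMS n u b ρ x ∧ 0 ≤ zMS n μ u b ρ x} with hT
  have hlam : lambdaB n μ u b = sInf T := rfl
  set l := lambdaB n μ u b
  have hmem : ∀ a, a ∈ T ↔ 0 < a ∧ ∀ ρ, a ≤ ρ → GapsNonneg n μ u b ρ⁻¹ := fun a =>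
    and_congr_right fun ha => forall₂_congr fun ρ hρ => (gapsNonneg_inv_iff (ha.trans_le hρ)).symm
  have hTne : T.Nonempty := by
    by_contra hne
    rw [Set.not_nonempty_iff_eq_empty] at hne
    rw [hlam, hne, Real.sInf_empty] at hb
    exact hb.false
  have hTb : BddBelow T := ⟨0, fun a ha => ha.1.le⟩
  have hgt : ∀ ρ, l < ρ → GapsNonneg n μ u b ρ⁻¹ := by
    intro ρ hρ
    obtain ⟨a, ha, haρ⟩ := exists_lt_of_csInf_lt hTne (hlam ▸ hρ)
    exact ((hmem a).1 ha).2 ρ haρ.le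
  have hl0 : 0 < l⁻¹ := inv_pos.2 hb
  have hcrit : GapsNonneg n μ u b l⁻¹ :=
    gapsNonneg_of_forall_lt hn1 hμ0 hμn huc hB hl0 fun r hr hrl => by
      simpa using hgt r⁻¹ ((lt_inv_comm₀ hr hb).1 hrl)
  have hzero : ∀ y ∈ ball b l⁻¹ \ {b}, reflGap u b l⁻¹ y = 0 := by
    by_contra! hne
    obtain ⟨y₀, hy₀, hy₀ne⟩ := hne
    obtain ⟨s', hs', hall⟩ := hcrit.exists_forall_Icc hn1 hμ0 hμn huc hB hIE hl0 hy₀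
      ((hcrit y₀ hy₀).1.lt_of_ne hy₀ne.symm)
    have hs'0 : 0 < s' := hl0.trans hs'
    have hs'T : s'⁻¹ ∈ T := by
      refine (hmem _).2 ⟨inv_pos.2 hs'0, fun ρ hρ => ?_⟩
      have hρ0 : 0 < ρ := (inv_pos.2 hs'0).trans_le hρ
      rcases lt_or_ge l ρ with hlρ | hlρ
      · exact hgt ρ hlρ
      · exact hall _ ⟨inv_anti₀ hρ0 hlρ, (inv_le_comm₀ hs'0 hρ0).1 hρ⟩
    have h1 : l ≤ s'⁻¹ := hlam ▸ csInf_le hTb hs'T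
    exact absurd (inv_lt_of_inv_lt₀ hb hs') (not_lt.2 h1)
  intro x hx hxl
  have hy := add_smul_mem_punctured_ball (b := b) hb hx hxl
  rw [wMS_eq_reflGap hb hx, zMS_eq_kelvinGap hb hx, hzero _ hy,
    kelvinGap_eq_zero hn1 hμ0 hμn huc hB hl0 hzero hy]
  simp
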